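/- Let n ≥ 5 and m ∈ ℕ. Suppose a, b ∈ ℝ are such that (∫_{S^{n-1}} |f|^{2(n-1)/(n-4)} dμ_{S^{n-1}})^{(n-4)/(n-1)} ≤ a ∫_{𝔹ⁿ} (Δu)² dx + b ∫_{S^{n-1}} ( |∇f|²_{S^{n-1}} + b_n f² ) dμ_{S^{n-1}} holds for every f ∈ C^∞(S^{n-1}) with ∫_{S^{n-1}} p |f|^{2(n-1)/(n-4)} dμ_{S^{n-1}} = 0 for all p ∈ P̊_m and every u ∈ H²(𝔹ⁿ) satisfying the boundary conditions u = f and ∂u/∂r = -((n-4)/2) f on S^{n-1}, where b_n = n(n-4)/2. Then a ≥ α(n) / Θ(m, (n-4)/(n-1), n-1), where α(n) = 4 / ( n(n-2)(n-4) |S^{n-1}|^{3/(n-1)} ). -/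

import Mathlib

open MeasureTheory Metric Filter
open scoped ENNReal RealInnerProductSpace

noncomputable section

abbrev E (n : ℕ) : Type := EuclideanSpace ℝ (Fin n)

/-- The standard surface measure on the unit sphere `S^{n-1}`, as a Borel measure on `ℝⁿ`. -/
def sphMeasure (n : ℕ) : Measure (E n) :=
  Measure.map Subtype.val ((volume : Measure (E n)).toSphere)

/-- `|S^{n-1}|` : the total mass of the surface measure. -/
def SA (n : ℕ) : ℝ := (sphMeasure n Set.univ).toReal

/-- `P̊_m` : polynomials of degree at most `m` with zero mean on the sphere. -/
def P0 (n m : ℕ) : Set (MvPolynomial (Fin n) ℝ) :=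
  {p | p.totalDegree ≤ m ∧ ∫ x, MvPolynomial.eval (fun i => x i) p ∂(sphMeasure n) = 0}

/-- `Θ(m, θ, n-1)` : the infimum of `Σ_i ν_iᶿ` over all probability measures
`ν = Σ_i ν_i δ_{ξ_i}` on `S^{n-1}` supported on countably many points such that
`∫ p dν = 0` for all `p ∈ P̊_m`. -/
def Theta (n m : ℕ) (θ : ℝ) : ℝ :=
  sInf {t : ℝ | ∃ (ξ : ℕ → E n) (w : ℕ → ℝ),
    (∀ i, ξ i ∈ Metric.sphere (0 : E n) 1) ∧ (∀ i, 0 ≤ w i) ∧ Summable w ∧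
    (∑' i, w i) = 1 ∧
    (∀ p ∈ P0 n m, (∑' i, w i * MvPolynomial.eval (fun j => ξ i j) p) = 0) ∧
    Summable (fun i => w i ^ θ) ∧ t = ∑' i, w i ^ θ}

/-- The Euclidean Laplacian `Δu = Σ_i ∂²u/∂x_i²`. -/
def lap (n : ℕ) (u : E n → ℝ) (x : E n) : ℝ :=
  ∑ i : Fin n, fderiv ℝ (fun y => fderiv ℝ u y (EuclideanSpace.single i 1)) x
    (EuclideanSpace.single i 1)

/-- `|∇f|²_{S^{n-1}}` at a point `x` of the unit sphere: the squared norm of the tangential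
gradient, i.e. `‖∇f‖² - ⟨∇f, x⟩²`. -/
def tgradNormSq (n : ℕ) (f : E n → ℝ) (x : E n) : ℝ :=
  ‖gradient f x‖ ^ 2 - (fderiv ℝ f x x) ^ 2

open scoped Pointwise

instance sph_fin (n : ℕ) : IsFiniteMeasure (sphMeasure n) := by
  unfold sphMeasure; infer_instance

theorem sph_emb (n : ℕ) : MeasurableEmbedding (Subtype.val : sphere (0 : E n) 1 → E n) :=
  MeasurableEmbedding.subtype_coe isClosed_sphere.measurableSet

theorem sph_ae (n : ℕ) : ∀ᵐ x ∂(sphMeasure n), ‖x‖ = 1 := by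
  unfold sphMeasure
  rw [(sph_emb n).ae_map_iff]
  exact Eventually.of_forall fun x => by simpa using x.2

theorem sph_polar (n : ℕ) (hn : 1 ≤ n) (f : E n → ℝ≥0∞) (hf : Measurable f) :
    ∫⁻ x, f x = ∫⁻ x, (∫⁻ r in Set.Ioi (0:ℝ), ENNReal.ofReal (r ^ (n - 1)) * f (r • x)) ∂(sphMeasure n) := by
  have : Nonempty (Fin n) := ⟨⟨0, hn⟩⟩
  have h1 : ∫⁻ x, f x = ∫⁻ x : ({(0 : E n)}ᶜ : Set (E n)), f x.1 ∂((volume : Measure (E n)).comap (↑)) := by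
    rw [lintegral_subtype_comap (measurableSet_singleton _).compl f, restrict_compl_singleton]
  have hmp := (volume : Measure (E n)).measurePreserving_homeomorphUnitSphereProd
  have h2 := hmp.symm (homeomorphUnitSphereProd (E n)).toMeasurableEquiv
  have h3 := h2.lintegral_comp_emb (MeasurableEquiv.measurableEmbedding _) (fun x => f x.1)
  rw [h1, ← h3, lintegral_prod]
  · unfold sphMeasure
    rw [(sph_emb n).lintegral_map]
    refine lintegral_congr fun x => ?_
    rw [Measure.volumeIoiPow, lintegral_withDensity_eq_lintegral_mul₀]
    · have := lintegral_subtype_comap (μ := volume) (measurableSet_Ioi (a := (0:ℝ)))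
        (fun r : ℝ => ENNReal.ofReal (r ^ (n-1)) * f (r • x.1))
      rw [← this]
      simp only [finrank_euclideanSpace, Fintype.card_fin]
      rfl
    · fun_prop
    · refine Measurable.aemeasurable ?_
      exact (hf.comp measurable_subtype_coe).comp ((homeomorphUnitSphereProd (E n)).toMeasurableEquiv.symm.measurable.comp (measurable_prodMk_left))
  · exact ((hf.comp measurable_subtype_coe).comp ((homeomorphUnitSphereProd (E n)).toMeasurableEquiv.symm.measurable)).aemeasurable

theorem sph_inv (n : ℕ) (L : E n ≃ₗᵢ[ℝ] E n) : MeasurePreserving L (sphMeasure n) (sphMeasure n) := by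
  have key : ∀ s, MeasurableSet s → sphMeasure n s = n * volume (Set.Ioo (0:ℝ) 1 • (s ∩ sphere (0 : E n) 1)) := by
    intro s hs
    unfold sphMeasure
    rw [(sph_emb n).map_apply, Measure.toSphere_apply' _ ((sph_emb n).measurable hs)]
    simp [Subtype.image_preimage_coe, Set.inter_comm]
  refine ⟨L.continuous.measurable, ?_⟩
  ext s hs
  rw [Measure.map_apply L.continuous.measurable hs, key _ hs, key _ (L.continuous.measurable hs)]
  congr 1
  rw [← L.symm.measurePreserving.measure_preimage_equiv (f := L.symm.toHomeomorph.toMeasurableEquiv)]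
  congr 1
  ext x
  simp only [Set.mem_smul, Set.mem_inter_iff, Set.mem_preimage, mem_sphere, dist_zero_right]
  constructor
  · rintro ⟨r, hr, y, ⟨hy, hy1⟩, h⟩
    refine ⟨r, hr, L y, ⟨hy, by simpa using hy1⟩, ?_⟩
    rw [← map_smul, h]
    exact L.apply_symm_apply x
  · rintro ⟨r, hr, y, ⟨hy, hy1⟩, rfl⟩
    refine ⟨r, hr, L.symm y, ⟨by simpa using hy, by simpa using hy1⟩, ?_⟩
    rw [← map_smul]
    rfl

theorem SA_pos (n : ℕ) (hn : 1 ≤ n) : 0 < SA n := by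
  have : Nonempty (Fin n) := ⟨⟨0, hn⟩⟩
  unfold SA
  refine ENNReal.toReal_pos ?_ (measure_ne_top _ _)
  unfold sphMeasure
  rw [Measure.map_apply (sph_emb n).measurable MeasurableSet.univ]
  simp only [Set.preimage_univ]
  rw [Ne, Measure.measure_univ_eq_zero]
  exact Measure.toSphere_ne_zero _

theorem sph_atom (n : ℕ) (hn : 2 ≤ n) (e : E n) : sphMeasure n {e} = 0 := by
  have : Nonempty (Fin n) := ⟨⟨0, by omega⟩⟩
  unfold sphMeasure
  rw [(sph_emb n).map_apply, Measure.toSphere_apply' _ ((sph_emb n).measurable (measurableSet_singleton _))]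
  have : volume (Set.Ioo (0:ℝ) 1 • (Subtype.val '' (Subtype.val ⁻¹' {e} : Set (sphere (0 : E n) 1)))) = 0 := by
    refine measure_mono_null (t := (Submodule.span ℝ {e} : Set (E n))) ?_ ?_
    · rintro x ⟨r, hr, y, ⟨z, hz, rfl⟩, rfl⟩
      simp only [Set.mem_preimage, Set.mem_singleton_iff] at hz
      simp only [hz]
      exact Submodule.smul_mem _ _ (Submodule.mem_span_singleton_self e)
    · apply Measure.addHaar_submodule
      intro h
      have := finrank_span_le_card (R := ℝ) ({e} : Set (E n))
      rw [h] at this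
      simp at this
      omega
  rw [this, mul_zero]

/-- orthonormal pairs can be moved to each other -/
theorem exists_isom_pair (n : ℕ) (a b c d : E n) (ha : ‖a‖ = 1) (hb : ‖b‖ = 1) (hab : inner ℝ a b = 0)
    (hc : ‖c‖ = 1) (hd : ‖d‖ = 1) (hcd : inner ℝ c d = 0) : ∃ L : E n ≃ₗᵢ[ℝ] E n, L a = c ∧ L b = d := by
  have o1 : Orthonormal ℝ ![a, b] := by
    constructor
    · intro i; fin_cases i <;> simp [ha, hb]
    · intro i j hij; fin_cases i <;> fin_cases j <;> simp_all [real_inner_comm]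
  have o2 : Orthonormal ℝ ![c, d] := by
    constructor
    · intro i; fin_cases i <;> simp [hc, hd]
    · intro i j hij; fin_cases i <;> fin_cases j <;> simp_all [real_inner_comm]
  let b1 := Module.Basis.span o1.linearIndependent
  let S := Submodule.span ℝ (Set.range ![a, b])
  have hb1 : Orthonormal ℝ b1 := by
    have : (Subtype.val ∘ b1 : Fin 2 → E n) = ![a,b] := by
      ext i; simp [b1, Module.Basis.span_apply]
    have h2 : Orthonormal ℝ (S.subtypeₗᵢ ∘ b1) := by
      have : (S.subtypeₗᵢ ∘ b1 : Fin 2 → E n) = ![a,b] := this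
      rw [this]; exact o1
    exact (S.subtypeₗᵢ.orthonormal_comp_iff).1 h2
  let ob := b1.toOrthonormalBasis hb1
  let T : S →ₗ[ℝ] E n := b1.constr ℝ ![c, d]
  have hT : ∀ i, T (b1 i) = ![c,d] i := fun i => by simp [T, Module.Basis.constr_basis]
  let T' : S →ₗᵢ[ℝ] E n := T.isometryOfOrthonormal hb1 (by
    have : (T ∘ b1) = ![c,d] := funext hT
    rw [this]; exact o2)
  let L0 := T'.extend
  let L := L0.toLinearIsometryEquiv rfl
  have hL : ∀ i, L (![a,b] i) = ![c,d] i := by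
    intro i
    have h1 : (b1 i : E n) = ![a,b] i := by simp [b1, Module.Basis.span_apply]
    rw [← h1, ← hT i]
    exact LinearIsometry.extend_apply T' (b1 i)
  exact ⟨L, by simpa using hL 0, by simpa using hL 1⟩

theorem exists_orth (n : ℕ) (hn : 2 ≤ n) (a : E n) (ha : ‖a‖ = 1) : ∃ b : E n, ‖b‖ = 1 ∧ inner ℝ a b = 0 := by
  have : (Submodule.span ℝ {a})ᗮ ≠ ⊥ := by
    intro h
    have h2 := Submodule.finrank_add_finrank_orthogonal (Submodule.span ℝ {a})
    rw [h] at h2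
    have := finrank_span_le_card (R := ℝ) ({a} : Set (E n))
    simp at this h2
    omega
  obtain ⟨b, hb, hb0⟩ := Submodule.exists_mem_ne_zero_of_ne_bot this
  refine ⟨(‖b‖)⁻¹ • b, by simp [norm_smul, hb0], ?_⟩
  rw [inner_smul_right, Submodule.mem_orthogonal_singleton_iff_inner_right.1 hb, mul_zero]

theorem exists_isom (n : ℕ) (hn : 2 ≤ n) (a c : E n) (ha : ‖a‖ = 1) (hc : ‖c‖ = 1) :
    ∃ L : E n ≃ₗᵢ[ℝ] E n, L a = c := by
  obtain ⟨b, hb, hab⟩ := exists_orth n hn a ha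
  obtain ⟨d, hd, hcd⟩ := exists_orth n hn c hc
  obtain ⟨L, h, _⟩ := exists_isom_pair n a b c d ha hb hab hc hd hcd
  exact ⟨L, h⟩

def mom (n j : ℕ) : ℝ := Real.Gamma (((j:ℝ)+1)/2) * √Real.pi ^ (n-1) / Real.Gamma (((n:ℝ)+j)/2)

theorem mom_nonneg (n j : ℕ) : 0 ≤ mom n j := by
  unfold mom
  have h1 : 0 < Real.Gamma (((j:ℝ)+1)/2) := Real.Gamma_pos_of_pos (by positivity)
  have h2 : 0 ≤ Real.Gamma (((n:ℝ)+j)/2) := Real.Gamma_nonneg_of_nonneg (by positivity)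
  positivity

theorem gam_integrable (j : ℕ) : IntegrableOn (fun x : ℝ => x ^ j * Real.exp (-x^2)) (Set.Ioi 0) := by
  have := integrableOn_rpow_mul_exp_neg_rpow (s := (j:ℝ)) (p := 2) (by linarith [j.cast_nonneg (α := ℝ)]) (by norm_num)
  simpa using this

theorem gam_val (j : ℕ) : ∫ x in Set.Ioi (0:ℝ), x ^ j * Real.exp (-x^2) = Real.Gamma (((j:ℝ)+1)/2) / 2 := by
  have := integral_rpow_mul_exp_neg_rpow (q := (j:ℝ)) (p := 2) (by norm_num) (by linarith [j.cast_nonneg (α := ℝ)])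
  simp only [Real.rpow_natCast, Real.rpow_two] at this
  rw [this]; ring

theorem gam_lval (j : ℕ) : ∫⁻ x in Set.Ioi (0:ℝ), ENNReal.ofReal (x ^ j * Real.exp (-x^2)) =
    ENNReal.ofReal (Real.Gamma (((j:ℝ)+1)/2) / 2) := by
  rw [← gam_val, ofReal_integral_eq_lintegral_ofReal (gam_integrable j)]
  filter_upwards [ae_restrict_mem measurableSet_Ioi] with x hx
  have : (0:ℝ) < x := hx
  simp only [Pi.zero_apply]; positivity

theorem half_ind (j : ℕ) (hj : 1 ≤ j) : (fun x : ℝ => max x 0 ^ j * Real.exp (-x^2)) =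
    (Set.Ioi (0:ℝ)).indicator (fun x => x ^ j * Real.exp (-x^2)) := by
  ext x
  by_cases hx : 0 < x
  · rw [Set.indicator_of_mem (by exact hx), max_eq_left hx.le]
  · rw [Set.indicator_of_notMem (by exact hx), max_eq_right (not_lt.1 hx), zero_pow (by omega), zero_mul]

theorem gauss_moment (n : ℕ) (i0 : Fin n) (j : ℕ) (hj : 1 ≤ j) :
    ∫⁻ x : E n, ENNReal.ofReal (max (x i0) 0 ^ j * Real.exp (-‖x‖^2)) =
      ENNReal.ofReal (Real.Gamma (((j:ℝ)+1)/2) / 2 * √Real.pi ^ (n-1)) := by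
  let F : Fin n → ℝ → ℝ := fun i x => if i = i0 then max x 0 ^ j * Real.exp (-x^2) else Real.exp (-x^2)
  have hF : ∀ x : E n, max (x i0) 0 ^ j * Real.exp (-‖x‖^2) = ∏ i, F i (x i) := by
    intro x
    have : ∀ i, F i (x i) = (if i = i0 then max (x i0) 0 ^ j else 1) * Real.exp (-(x i)^2) := by
      intro i
      by_cases h : i = i0 <;> simp [F, h]
    simp_rw [this]
    rw [Finset.prod_mul_distrib, Finset.prod_ite_eq', if_pos (Finset.mem_univ _), ← Real.exp_sum,
      EuclideanSpace.norm_sq_eq]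
    simp
  have hIntg : ∀ i, Integrable (F i) := by
    intro i
    by_cases h : i = i0
    · have : F i = fun x : ℝ => max x 0 ^ j * Real.exp (-x^2) := by ext x; simp [F, h]
      rw [this, half_ind j hj, integrable_indicator_iff measurableSet_Ioi]
      exact gam_integrable j
    · have : F i = fun x : ℝ => Real.exp (-1 * x^2) := by ext x; simp [F, h]
      rw [this]
      exact integrable_exp_neg_mul_sq one_pos
  have hval : ∀ i, ∫ x, F i x = if i = i0 then Real.Gamma (((j:ℝ)+1)/2) / 2 else √Real.pi := by
    intro i
    by_cases h : i = i0
    · have : F i = fun x : ℝ => max x 0 ^ j * Real.exp (-x^2) := by ext x; simp [F, h]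
      rw [this, half_ind j hj, integral_indicator measurableSet_Ioi, gam_val, if_pos h]
    · have : F i = fun x : ℝ => Real.exp (-1 * x^2) := by ext x; simp [F, h]
      rw [this, integral_gaussian, if_neg h, div_one]
  have hI : Integrable (fun x : Fin n → ℝ => ∏ i, F i (x i)) := Integrable.fintype_prod hIntg
  have hmp := PiLp.volume_preserving_ofLp (Fin n)
  simp_rw [hF]
  have hc := hmp.lintegral_comp_emb (MeasurableEquiv.toLp 2 (Fin n → ℝ)).symm.measurableEmbedding
    (fun x => ENNReal.ofReal (∏ i, F i (x i)))
  rw [hc, ← ofReal_integral_eq_lintegral_ofReal hI, integral_fintype_prod_volume_eq_prod]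
  · simp_rw [hval]
    rw [Finset.prod_ite]
    simp [Finset.filter_eq', Finset.filter_ne']
  · refine Eventually.of_forall fun x => Finset.prod_nonneg fun i _ => ?_
    dsimp [F]; split_ifs <;> positivity

theorem sph_moment_coord (n : ℕ) (i0 : Fin n) (j : ℕ) (hj : 1 ≤ j) :
    ∫⁻ x, ENNReal.ofReal (max (x i0) 0 ^ j) ∂(sphMeasure n) = ENNReal.ofReal (mom n j) := by
  have hn : 1 ≤ n := by have := i0.2; omega
  have h1 := gauss_moment n i0 j hj
  rw [sph_polar n hn _ (by fun_prop)] at h1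
  have h2 : ∀ᵐ x ∂(sphMeasure n), ∫⁻ r in Set.Ioi (0:ℝ), ENNReal.ofReal (r ^ (n-1)) *
      ENNReal.ofReal (max ((r • x) i0) 0 ^ j * Real.exp (-‖r • x‖^2)) =
      ENNReal.ofReal (max (x i0) 0 ^ j) * ENNReal.ofReal (Real.Gamma (((n:ℝ)+j)/2) / 2) := by
    filter_upwards [sph_ae n] with x hx
    have h3 := gam_lval (n-1+j)
    have : (((n - 1 + j : ℕ) : ℝ) + 1) = n + j := by
      push_cast [Nat.cast_sub hn]; ring
    rw [this] at h3
    rw [← h3, ← lintegral_const_mul _ (by fun_prop)]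
    refine setLIntegral_congr_fun measurableSet_Ioi fun r hr => ?_
    have hr : (0:ℝ) < r := hr
    rw [← ENNReal.ofReal_mul (by positivity), ← ENNReal.ofReal_mul (by positivity)]
    congr 1
    rw [norm_smul, hx, PiLp.smul_apply, smul_eq_mul, show max (r * x i0) 0 = r * max (x i0) 0 by
      rw [mul_max_of_nonneg _ _ hr.le, mul_zero]]
    simp only [Real.norm_eq_abs, mul_one, sq_abs]
    rw [mul_pow, pow_add]; ring
  rw [lintegral_congr_ae h2, lintegral_mul_const _ (by fun_prop)] at h1
  have hg : 0 < Real.Gamma (((n:ℝ)+j)/2) := Real.Gamma_pos_of_pos (by positivity)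
  have hg' : ENNReal.ofReal (Real.Gamma (((n:ℝ)+j)/2) / 2) ≠ 0 := by
    simp [hg]
  rw [← ENNReal.mul_left_inj hg' ENNReal.ofReal_ne_top, h1, ← ENNReal.ofReal_mul (mom_nonneg _ _)]
  congr 1
  unfold mom
  field_simp

theorem sph_moment (n : ℕ) (hn : 2 ≤ n) (ξ : E n) (hξ : ‖ξ‖ = 1) (j : ℕ) (hj : 1 ≤ j) :
    ∫⁻ x, ENNReal.ofReal (max (inner ℝ ξ x) 0 ^ j) ∂(sphMeasure n) = ENNReal.ofReal (mom n j) := by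
  let i0 : Fin n := ⟨0, by omega⟩
  obtain ⟨L, hL⟩ := exists_isom n hn (EuclideanSpace.single i0 1) ξ (by simp) hξ
  rw [← sph_moment_coord n i0 j hj]
  have := (sph_inv n L).lintegral_comp_emb L.toHomeomorph.measurableEmbedding
    (fun x => ENNReal.ofReal (max (inner ℝ ξ x) 0 ^ j))
  rw [← this]
  refine lintegral_congr fun x => ?_
  rw [← hL, L.inner_map_map, EuclideanSpace.inner_single_left]
  simp

theorem SA_val (n : ℕ) (hn : 2 ≤ n) : SA n = 2 * √Real.pi ^ n / Real.Gamma ((n:ℝ)/2) := by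
  have : Nonempty (Fin n) := ⟨⟨0, by omega⟩⟩
  unfold SA sphMeasure
  rw [Measure.map_apply (sph_emb n).measurable MeasurableSet.univ]
  simp only [Set.preimage_univ, Measure.toSphere_apply_univ]
  rw [EuclideanSpace.volume_ball]
  have hn0 : (n:ℝ)/2 ≠ 0 := by positivity
  have hg : 0 < Real.Gamma ((n:ℝ)/2) := Real.Gamma_pos_of_pos (by positivity)
  simp only [Fintype.card_fin, finrank_euclideanSpace, ENNReal.ofReal_one, one_pow, one_mul]
  rw [ENNReal.toReal_mul, ENNReal.toReal_ofReal, Real.Gamma_add_one hn0, ENNReal.toReal_natCast]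
  · have : (n:ℝ) ≠ 0 := by positivity
    field_simp
  · rw [Real.Gamma_add_one hn0]; positivity

theorem mom_step (n j : ℕ) (hn : 1 ≤ n) : mom n (j+2) * ((n:ℝ)+j) = mom n j * ((j:ℝ)+1) := by
  unfold mom
  have h1 : ((j:ℝ)+1)/2 ≠ 0 := by positivity
  have hn' : (0:ℝ) < n := by exact_mod_cast hn
  have h2 : ((n:ℝ)+j)/2 ≠ 0 := by positivity
  rw [show (((j+2:ℕ):ℝ)+1)/2 = ((j:ℝ)+1)/2+1 by push_cast; ring,
    show ((n:ℝ)+((j+2:ℕ):ℝ))/2 = ((n:ℝ)+j)/2+1 by push_cast; ring, Real.Gamma_add_one h1, Real.Gamma_add_one h2]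
  have hg : 0 < Real.Gamma (((n:ℝ)+j)/2) := Real.Gamma_pos_of_pos (by positivity)
  field_simp

theorem mom_SA (n : ℕ) (hn : 3 ≤ n) : SA n = 2 ^ (n-1) * mom n (n-2) := by
  rw [SA_val n (by omega)]
  unfold mom
  obtain ⟨k, rfl⟩ : ∃ k, n = k + 3 := ⟨n-3, by omega⟩
  have h := Real.Gamma_mul_Gamma_add_half (((k:ℝ)+2)/2)
  simp only [show k + 3 - 2 = k + 1 by omega, show k + 3 - 1 = k + 2 by omega]
  push_cast
  rw [show ((k:ℝ)+3)/2 = ((k:ℝ)+2)/2+1/2 by ring, show ((k:ℝ)+1+1)/2 = ((k:ℝ)+2)/2 by ring,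
    show ((k:ℝ)+3+(k+1))/2 = 2 * (((k:ℝ)+2)/2) by ring]
  have g1 : 0 < Real.Gamma (((k:ℝ)+2)/2) := Real.Gamma_pos_of_pos (by positivity)
  have g2 : 0 < Real.Gamma (((k:ℝ)+2)/2+1/2) := Real.Gamma_pos_of_pos (by positivity)
  have g3 : 0 < Real.Gamma (2 * (((k:ℝ)+2)/2)) := Real.Gamma_pos_of_pos (by positivity)
  rw [div_eq_iff g2.ne', show (2 ^ (k + 2) * (Real.Gamma ((↑k + 2) / 2) * √Real.pi ^ (k + 2) / Real.Gamma (2 * ((↑k + 2) / 2))) * Real.Gamma ((↑k + 2) / 2 + 1 / 2)) = (2 ^ (k + 2) * √Real.pi ^ (k + 2) / Real.Gamma (2 * ((↑k + 2) / 2))) * (Real.Gamma ((↑k + 2) / 2) * Real.Gamma ((↑k + 2) / 2 + 1 / 2)) by ring, h]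
  have : (2:ℝ) ^ (1 - 2 * (((k:ℝ)+2)/2)) = 2 / 2 ^ (k+2) := by
    rw [show 1 - 2 * (((k:ℝ)+2)/2) = 1 - ((k+2:ℕ):ℝ) by push_cast; ring, Real.rpow_sub two_pos, Real.rpow_natCast, Real.rpow_one]
  rw [this]
  field_simp
  ring

theorem pow_tail (p : ℕ) (a : ℝ) (ha : 0 < a) :
    ∫⁻ r in Set.Ioi a, ENNReal.ofReal ((r ^ (p+2))⁻¹) = ENNReal.ofReal ((a ^ (p+1))⁻¹ / (p+1)) := by
  have hlt : (-((p+2 : ℕ):ℝ)) < -1 := by push_cast; linarith [p.cast_nonneg (α := ℝ)]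
  have e : ∀ r ∈ Set.Ioi a, r ^ (-((p+2 : ℕ):ℝ)) = (r ^ (p+2))⁻¹ := by
    intro r hr
    have : 0 < r := ha.trans hr
    rw [Real.rpow_neg this.le, Real.rpow_natCast]
  have hi : IntegrableOn (fun r : ℝ => (r ^ (p+2))⁻¹) (Set.Ioi a) :=
    (integrableOn_Ioi_rpow_of_lt hlt ha).congr_fun e measurableSet_Ioi
  rw [← ofReal_integral_eq_lintegral_ofReal hi, ← setIntegral_congr_fun measurableSet_Ioi e,
    integral_Ioi_rpow_of_lt hlt ha]
  · congr 1
    rw [show -((p+2 : ℕ):ℝ) + 1 = -((p+1 : ℕ) : ℝ) by push_cast; ring, Real.rpow_neg ha.le, Real.rpow_natCast]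
    push_cast
    rw [neg_div_neg_eq]
  · filter_upwards [ae_restrict_mem measurableSet_Ioi] with r hr
    have : 0 < r := ha.trans hr
    simp only [Pi.zero_apply]; positivity

theorem half_inner (k : ℕ) (δ c : ℝ) (hδ : 0 < δ) :
    ∫⁻ r in Set.Ioi (0:ℝ), ENNReal.ofReal (r ^ (k+4)) *
      (Set.Ioi δ).indicator (fun _ => ENNReal.ofReal (((r ^ (k+3))⁻¹ + ((k:ℝ)+3) * δ * (r * c) * (r ^ (k+5))⁻¹)^2)) (r * c) =
    ENNReal.ofReal ((δ ^ (k+1))⁻¹) * (ENNReal.ofReal (max c 0 ^ (k+1)) * ENNReal.ofReal (1/((k:ℝ)+1)) +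
      ENNReal.ofReal (max c 0 ^ (k+3)) * ENNReal.ofReal (2 * ((k:ℝ)+3) / ((k:ℝ)+2)) +
      ENNReal.ofReal (max c 0 ^ (k+5)) * ENNReal.ofReal ((k:ℝ)+3)) := by
  rcases le_or_gt c 0 with hc | hc
  · rw [max_eq_right hc]
    simp only [ne_eq, Nat.add_eq_zero_iff, one_ne_zero, OfNat.ofNat_ne_zero, and_false, not_false_eq_true, zero_pow, ENNReal.ofReal_zero, zero_mul, add_zero, mul_zero]
    rw [setLIntegral_congr_fun (g := fun _ => 0) measurableSet_Ioi, lintegral_zero]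
    intro r hr
    have hr : (0:ℝ) < r := hr
    have : r * c ∉ Set.Ioi δ := by
      simp only [Set.mem_Ioi, not_lt]; nlinarith
    simp only [Set.indicator_of_notMem this, mul_zero]
  · rw [max_eq_left hc.le]
    have hsub : Set.Ioi (δ / c) ⊆ Set.Ioi 0 := Set.Ioi_subset_Ioi (by positivity)
    have hpos : 0 < δ / c := by positivity
    have h1 : ∀ r ∈ Set.Ioi (0:ℝ), ENNReal.ofReal (r ^ (k+4)) *
      (Set.Ioi δ).indicator (fun _ => ENNReal.ofReal (((r ^ (k+3))⁻¹ + ((k:ℝ)+3) * δ * (r * c) * (r ^ (k+5))⁻¹)^2)) (r * c) = (Set.Ioi (δ/c)).indicator (fun r => ENNReal.ofReal ((r ^ (k+2))⁻¹) + ENNReal.ofReal (2 * ((k:ℝ)+3) * δ * c) * ENNReal.ofReal ((r ^ (k+1+2))⁻¹) + ENNReal.ofReal ((((k:ℝ)+3) * δ * c)^2) * ENNReal.ofReal ((r ^ (k+2+2))⁻¹)) r := by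
      intro r hr
      have hr : (0:ℝ) < r := hr
      by_cases h : δ / c < r
      · rw [Set.indicator_of_mem (by exact (div_lt_iff₀ hc).1 h), Set.indicator_of_mem (by exact h),
          ← ENNReal.ofReal_mul (by positivity), ← ENNReal.ofReal_mul (by positivity), ← ENNReal.ofReal_mul (by positivity),
          ← ENNReal.ofReal_add (by positivity) (by positivity), ← ENNReal.ofReal_add (by positivity) (by positivity)]
        congr 1
        field_simp
        ring
      · rw [Set.indicator_of_notMem, Set.indicator_of_notMem (by exact h), mul_zero]
        simp only [Set.mem_Ioi, not_lt] at h ⊢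
        exact (le_div_iff₀ hc).1 h
    rw [setLIntegral_congr_fun measurableSet_Ioi h1, setLIntegral_indicator measurableSet_Ioi,
      Set.inter_eq_left.2 hsub, lintegral_add_left (by fun_prop), lintegral_add_left (by fun_prop),
      lintegral_const_mul _ (by fun_prop), lintegral_const_mul _ (by fun_prop), pow_tail _ _ hpos, pow_tail _ _ hpos, pow_tail _ _ hpos]
    rw [← ENNReal.ofReal_mul (by positivity), ← ENNReal.ofReal_mul (by positivity), ← ENNReal.ofReal_mul (by positivity),
      ← ENNReal.ofReal_mul (by positivity), ← ENNReal.ofReal_mul (by positivity),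
          ← ENNReal.ofReal_add (by positivity) (by positivity), ← ENNReal.ofReal_add (by positivity) (by positivity),
          ← ENNReal.ofReal_add (by positivity) (by positivity), ← ENNReal.ofReal_add (by positivity) (by positivity),
          ← ENNReal.ofReal_mul (by positivity)]
    congr 1
    push_cast
    rw [div_pow, div_pow, div_pow]
    field_simp
    ring

theorem half_integral (k : ℕ) (ξ : E (k+5)) (hξ : ‖ξ‖ = 1) (δ : ℝ) (hδ : 0 < δ) :
    ∫⁻ X in {X : E (k+5) | δ < inner ℝ ξ X}, ENNReal.ofReal
      (((‖X‖ ^ (k+3))⁻¹ + ((k:ℝ)+3) * δ * inner ℝ ξ X * (‖X‖ ^ (k+5))⁻¹)^2) =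
    ENNReal.ofReal ((δ ^ (k+1))⁻¹ * (((k:ℝ)+5) * ((k:ℝ)+3) / (2 * ((k:ℝ)+1)) * mom (k+5) (k+3))) := by
  have hms : MeasurableSet {X : E (k+5) | δ < inner ℝ ξ X} :=
    measurableSet_lt measurable_const (by fun_prop)
  rw [← lintegral_indicator hms, sph_polar (k+5) (by omega) _ (Measurable.indicator (by fun_prop) hms)]
  have h2 : ∀ᵐ x ∂(sphMeasure (k+5)), ∫⁻ r in Set.Ioi (0:ℝ), ENNReal.ofReal (r ^ (k+5-1)) *
    ({X : E (k+5) | δ < inner ℝ ξ X}.indicator (fun X => ENNReal.ofReal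
      (((‖X‖ ^ (k+3))⁻¹ + ((k:ℝ)+3) * δ * inner ℝ ξ X * (‖X‖ ^ (k+5))⁻¹)^2)) (r • x)) = 
    ENNReal.ofReal ((δ ^ (k+1))⁻¹) * (ENNReal.ofReal (max (inner ℝ ξ x) 0 ^ (k+1)) * ENNReal.ofReal (1/((k:ℝ)+1)) +
      ENNReal.ofReal (max (inner ℝ ξ x) 0 ^ (k+3)) * ENNReal.ofReal (2 * ((k:ℝ)+3) / ((k:ℝ)+2)) +
      ENNReal.ofReal (max (inner ℝ ξ x) 0 ^ (k+5)) * ENNReal.ofReal ((k:ℝ)+3)) := by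
    filter_upwards [sph_ae (k+5)] with x hx
    rw [← half_inner k δ _ hδ]
    refine setLIntegral_congr_fun measurableSet_Ioi fun r hr => ?_
    have hr : (0:ℝ) < r := hr
    congr 1
    by_cases h : δ < r * inner ℝ ξ x
    · rw [Set.indicator_of_mem (by simpa [inner_smul_right] using h), Set.indicator_of_mem (by exact h)]
      rw [norm_smul, hx, inner_smul_right]
      simp [abs_of_pos hr]
    · rw [Set.indicator_of_notMem (by simpa [inner_smul_right] using h), Set.indicator_of_notMem (by exact h)]
  rw [lintegral_congr_ae h2, lintegral_const_mul _ (by fun_prop), lintegral_add_left (by fun_prop), lintegral_add_left (by fun_prop),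
    lintegral_mul_const _ (by fun_prop), lintegral_mul_const _ (by fun_prop), lintegral_mul_const _ (by fun_prop),
    sph_moment _ (by omega) ξ hξ _ (by omega), sph_moment _ (by omega) ξ hξ _ (by omega), sph_moment _ (by omega) ξ hξ _ (by omega)]
  have m1 := mom_nonneg (k+5) (k+1)
  have m2 := mom_nonneg (k+5) (k+3)
  have m3 := mom_nonneg (k+5) (k+5)
  rw [← ENNReal.ofReal_mul (by positivity), ← ENNReal.ofReal_mul (by positivity), ← ENNReal.ofReal_mul (by positivity),
          ← ENNReal.ofReal_add (by positivity) (by positivity), ← ENNReal.ofReal_add (by positivity) (by positivity),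
          ← ENNReal.ofReal_mul (by positivity)]
  have s1 := mom_step (k+5) (k+1) (by omega)
  have s2 := mom_step (k+5) (k+3) (by omega)
  push_cast at s1 s2
  congr 2
  have e1 : mom (k+5) (k+1) = mom (k+5) (k+3) * (2*k+6) / (k+2) := by
    rw [eq_div_iff (by positivity)]; linarith
  have e2 : mom (k+5) (k+5) = mom (k+5) (k+3) * (k+4) / (2*k+8) := by
    rw [eq_div_iff (by positivity)]; linarith
  rw [e1, e2]
  field_simp
  ring

def boost (n : ℕ) (e : E n) (γ κ : ℝ) (y : E n) : E n := y + ((γ - 1) * inner ℝ e y - κ * ‖y‖) • e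

theorem boost_inner (n : ℕ) (e : E n) (he : ‖e‖ = 1) (γ κ : ℝ) (y : E n) :
    inner ℝ e (boost n e γ κ y) = γ * inner ℝ e y - κ * ‖y‖ := by
  unfold boost
  rw [inner_add_right, inner_smul_right, real_inner_self_eq_norm_sq, he]; ring

theorem boost_pos (n : ℕ) (e : E n) (he : ‖e‖ = 1) (γ κ : ℝ) (hγ : 0 < γ) (h : γ^2 - κ^2 = 1) (y : E n) (hy : y ≠ 0) :
    0 < γ * ‖y‖ - κ * inner ℝ e y := by
  have h1 : |inner ℝ e y| ≤ ‖y‖ := by simpa [he] using abs_real_inner_le_norm e y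
  have h2 : |κ| < γ := abs_lt_of_sq_lt_sq (by linarith) hγ.le
  have h3 : 0 < ‖y‖ := norm_pos_iff.2 hy
  have h4 : κ * inner ℝ e y ≤ |κ| * ‖y‖ := by
    calc _ ≤ |κ * inner ℝ e y| := le_abs_self _
      _ = |κ| * |inner ℝ e y| := abs_mul _ _
      _ ≤ _ := by gcongr
  nlinarith

theorem boost_norm (n : ℕ) (e : E n) (he : ‖e‖ = 1) (γ κ : ℝ) (hγ : 0 < γ) (h : γ^2 - κ^2 = 1) (y : E n) :
    ‖boost n e γ κ y‖ = γ * ‖y‖ - κ * inner ℝ e y := by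
  have h0 : 0 ≤ γ * ‖y‖ - κ * inner ℝ e y := by
    by_cases hy : y = 0
    · simp [hy]
    · exact (boost_pos n e he γ κ hγ h y hy).le
  rw [← sq_eq_sq₀ (norm_nonneg _) h0]
  unfold boost
  rw [norm_add_sq_real, inner_smul_right, norm_smul, he, real_inner_comm, mul_one, Real.norm_eq_abs, sq_abs]
  have : κ^2 = γ^2 - 1 := by linarith
  ring_nf
  rw [this]; ring

theorem boost_inv (n : ℕ) (e : E n) (he : ‖e‖ = 1) (γ κ : ℝ) (hγ : 0 < γ) (h : γ^2 - κ^2 = 1) (y : E n) :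
    boost n e γ (-κ) (boost n e γ κ y) = y := by
  have h1 := boost_norm n e he γ κ hγ h y
  have h2 := boost_inner n e he γ κ y
  rw [boost, h1, h2, boost, add_assoc, ← add_smul]
  have : ((γ - 1) * inner ℝ e y - κ * ‖y‖ + ((γ - 1) * (γ * inner ℝ e y - κ * ‖y‖) - -κ * (γ * ‖y‖ - κ * inner ℝ e y))) = 0 := by
    have : κ^2 = γ^2 - 1 := by linarith
    ring_nf
    rw [this]; ring
  rw [this, zero_smul, add_zero]

theorem exp_lval (p : ℕ) (b : ℝ) (hb : 0 < b) : ∫⁻ r in Set.Ioi (0:ℝ), ENNReal.ofReal (r ^ p * Real.exp (-(b * r))) =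
    ENNReal.ofReal ((1/b)^(p+1)) * ENNReal.ofReal (Real.Gamma ((p:ℝ)+1)) := by
  have h := Real.integral_rpow_mul_exp_neg_mul_Ioi (a := (p:ℝ)+1) (r := b) (by positivity) hb
  simp only [add_sub_cancel_right, Real.rpow_natCast] at h
  rw [show ((p:ℝ)+1) = ((p+1:ℕ):ℝ) by push_cast; ring, Real.rpow_natCast] at h
  have hg : 0 < Real.Gamma (((p+1:ℕ):ℝ)) := Real.Gamma_pos_of_pos (by positivity)
  have hi : IntegrableOn (fun r : ℝ => r ^ p * Real.exp (-(b * r))) (Set.Ioi 0) := by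
    refine not_imp_comm.1 integral_undef ?_
    rw [h]; positivity
  rw [← ofReal_integral_eq_lintegral_ofReal hi, h, ENNReal.ofReal_mul (by positivity)]
  · push_cast; rfl
  · filter_upwards [ae_restrict_mem measurableSet_Ioi] with x hx
    have : (0:ℝ) < x := hx
    simp only [Pi.zero_apply]; positivity

theorem boost_sphere (n : ℕ) (hn : 2 ≤ n) (e : E n) (he : ‖e‖ = 1) (γ κ : ℝ) (hγ : 0 < γ) (h : γ^2 - κ^2 = 1) :
    ∫⁻ x, ENNReal.ofReal ((1 / (γ - κ * inner ℝ e x)) ^ (n-1)) ∂(sphMeasure n) = sphMeasure n Set.univ := by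
  obtain ⟨p, rfl⟩ : ∃ p, n = p + 2 := ⟨n - 2, by omega⟩
  let S : Set (E (p+2)) := {0}ᶜ
  have hS : MeasurableSet S := (measurableSet_singleton _).compl
  let Φ := boost (p+2) e γ κ
  let D : E (p+2) → (E (p+2) →L[ℝ] E (p+2)) := fun y =>
    ContinuousLinearMap.id ℝ _ + (((γ - 1) • innerSL ℝ e - (κ * ‖y‖⁻¹) • innerSL ℝ y)).smulRight e
  have hinj : Function.Injective Φ := by
    intro y z hyz
    rw [← boost_inv (p+2) e he γ κ hγ h y, ← boost_inv (p+2) e he γ κ hγ h z]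
    exact congrArg _ hyz
  have hΦ0 : Φ 0 = 0 := by simp [Φ, boost]
  have himg : Φ '' S = S := by
    ext z
    constructor
    · rintro ⟨y, hy, rfl⟩
      intro hz
      exact hy (hinj (hz.trans hΦ0.symm))
    · intro hz
      have h' : γ^2 - (-κ)^2 = 1 := by linarith
      have hz2 : Φ (boost (p+2) e γ (-κ) z) = z := by
        have := boost_inv (p+2) e he γ (-κ) hγ h' z
        rwa [neg_neg] at this
      refine ⟨boost (p+2) e γ (-κ) z, ?_, hz2⟩
      intro h0
      rw [Set.mem_singleton_iff] at h0
      rw [h0, hΦ0] at hz2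
      exact hz hz2.symm
  have hD : ∀ y ∈ S, HasFDerivWithinAt Φ (D y) S y := by
    intro y hy
    have hy : y ≠ 0 := hy
    have hn1 : HasFDerivAt (fun y : E (p+2) => ‖y‖) (‖y‖⁻¹ • innerSL ℝ y) y := by
      have := (hasStrictFDerivAt_norm_sq y).hasFDerivAt.sqrt (by simpa using hy)
      simp only [Real.sqrt_sq (norm_nonneg _)] at this
      refine this.congr_fderiv ?_
      have hy' : ‖y‖ ≠ 0 := by simpa using hy
      rw [← Nat.cast_smul_eq_nsmul ℝ 2, smul_smul]
      congr 1
      push_cast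
      field_simp
    have hn2 : HasFDerivAt (fun y : E (p+2) => inner ℝ e y) (innerSL ℝ e) y := (innerSL ℝ e).hasFDerivAt
    have := (hasFDerivAt_id y).add (((hn2.const_mul (γ-1)).sub (hn1.const_mul κ)).smul_const e)
    refine (this.congr_fderiv ?_).hasFDerivWithinAt
    simp only [D]
    rw [smul_smul]
  have hdet : ∀ y ∈ S, (D y).det = ‖Φ y‖ / ‖y‖ := by
    intro y hy
    have hy : y ≠ 0 := hy
    have h3 : 0 < ‖y‖ := norm_pos_iff.2 hy
    have e1 : (D y).det = (LinearMap.transvection (((γ - 1) • innerSL ℝ e - (κ * ‖y‖⁻¹) • innerSL ℝ y : E (p+2) →L[ℝ] ℝ) : E (p+2) →ₗ[ℝ] ℝ) e).det := by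
      rw [ContinuousLinearMap.det]
      rfl
    rw [e1, LinearMap.transvection.det, boost_norm (p+2) e he γ κ hγ h]
    simp [he, real_inner_comm]
    field_simp
    ring
  have key := lintegral_image_eq_lintegral_abs_det_fderiv_mul volume hS hD hinj.injOn
    (fun z => ENNReal.ofReal (Real.exp (-‖z‖) / ‖z‖))
  rw [himg] at key
  have k2 : ∫⁻ x in S, ENNReal.ofReal |(D x).det| * ENNReal.ofReal (Real.exp (-‖Φ x‖) / ‖Φ x‖) =
      ∫⁻ x in S, ENNReal.ofReal (Real.exp (-(γ * ‖x‖ - κ * inner ℝ e x)) / ‖x‖) := by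
    refine setLIntegral_congr_fun hS fun y hy => ?_
    have h3 : 0 < ‖y‖ := norm_pos_iff.2 hy
    have h4 : 0 < ‖Φ y‖ := by
      rw [boost_norm (p+2) e he γ κ hγ h]; exact boost_pos (p+2) e he γ κ hγ h y hy
    rw [hdet y hy, ← ENNReal.ofReal_mul (by positivity), abs_of_pos (by positivity), ← boost_norm (p+2) e he γ κ hγ h]
    congr 1
    change _ = Real.exp (-‖Φ y‖) / ‖y‖
    field_simp
  rw [k2, restrict_compl_singleton, sph_polar _ (by omega) _ (by fun_prop), sph_polar _ (by omega) _ (by fun_prop)] at key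
  have i1 : ∀ᵐ x ∂(sphMeasure (p+2)), ∫⁻ r in Set.Ioi (0:ℝ), ENNReal.ofReal (r ^ (p+2-1)) * ENNReal.ofReal (Real.exp (-‖r • x‖) / ‖r • x‖)
     = ENNReal.ofReal (Real.Gamma ((p:ℝ)+1)) := by
    filter_upwards [sph_ae (p+2)] with x hx
    have := exp_lval p 1 one_pos
    simp only [div_one, one_pow, ENNReal.ofReal_one, one_mul] at this
    rw [← this]
    refine setLIntegral_congr_fun measurableSet_Ioi fun r hr => ?_
    have hr : (0:ℝ) < r := hr
    rw [norm_smul, hx, ← ENNReal.ofReal_mul (by positivity)]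
    congr 1
    simp only [Real.norm_eq_abs, abs_of_pos hr, mul_one]
    rw [show p + 2 - 1 = p + 1 by omega, pow_succ]
    field_simp
  have i2 : ∀ᵐ x ∂(sphMeasure (p+2)), ∫⁻ r in Set.Ioi (0:ℝ), ENNReal.ofReal (r ^ (p+2-1)) * ENNReal.ofReal (Real.exp (-(γ * ‖r • x‖ - κ * inner ℝ e (r • x))) / ‖r • x‖)
     = ENNReal.ofReal ((1 / (γ - κ * inner ℝ e x)) ^ (p+2-1)) * ENNReal.ofReal (Real.Gamma ((p:ℝ)+1)) := by
    filter_upwards [sph_ae (p+2)] with x hx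
    have hb : 0 < γ - κ * inner ℝ e x := by
      have := boost_pos (p+2) e he γ κ hγ h x (by rintro rfl; simp at hx)
      rwa [hx, mul_one] at this
    have := exp_lval p _ hb
    rw [show p + 2 - 1 = p + 1 by omega, ← this]
    refine setLIntegral_congr_fun measurableSet_Ioi fun r hr => ?_
    have hr : (0:ℝ) < r := hr
    rw [norm_smul, hx, ← ENNReal.ofReal_mul (by positivity), inner_smul_right]
    congr 1
    simp only [Real.norm_eq_abs, abs_of_pos hr, mul_one]
    rw [show (γ * r - κ * (r * inner ℝ e x)) = (γ - κ * inner ℝ e x) * r by ring, pow_succ]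
    field_simp
  rw [lintegral_congr_ae i1, lintegral_congr_ae i2, lintegral_mul_const _ (by fun_prop), lintegral_const, mul_comm] at key
  have hg : 0 < Real.Gamma ((p:ℝ)+1) := Real.Gamma_pos_of_pos (by positivity)
  rw [ENNReal.mul_left_inj (by simp [hg]) ENNReal.ofReal_ne_top] at key
  exact key.symm

theorem conf_sphere (n : ℕ) (hn : 2 ≤ n) (e : E n) (he : ‖e‖ = 1) (δ : ℝ) (hδ : 0 < δ) :
    ∫⁻ x, ENNReal.ofReal ((δ * (2 + δ) / (‖x‖^2 - 2 * (1+δ) * inner ℝ e x + (1+δ)^2)) ^ (n-1)) ∂(sphMeasure n) =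
      sphMeasure n Set.univ := by
  have hC : 0 < δ * (2+δ) := by positivity
  rw [← boost_sphere n hn e he (((1+δ)^2+1)/(δ * (2+δ))) (2*(1+δ)/(δ * (2+δ))) (by positivity)
    (by field_simp; ring)]
  refine lintegral_congr_ae ?_
  filter_upwards [sph_ae n] with x hx
  congr 2
  rw [hx]
  have h1 : (((1+δ)^2+1)/(δ * (2+δ))) - (2*(1+δ)/(δ * (2+δ))) * inner ℝ e x =
    (1^2 - 2 * (1+δ) * inner ℝ e x + (1+δ)^2) / (δ * (2+δ)) := by field_simp; ring
  rw [h1, one_div_div]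

theorem ball_pow_int (n : ℕ) (hn : 2 ≤ n) (ξ : E n) :
    ∫⁻ y, (ball ξ 4).indicator (fun y => ENNReal.ofReal ((‖y - ξ‖^(n-1))⁻¹)) y < ⊤ := by
  have e1 : ∫⁻ y, (ball ξ 4).indicator (fun y => ENNReal.ofReal ((‖y - ξ‖^(n-1))⁻¹)) y =
      ∫⁻ y, (ball (0:E n) 4).indicator (fun y => ENNReal.ofReal ((‖y‖^(n-1))⁻¹)) y := by
    rw [← lintegral_sub_right_eq_self (fun y => (ball (0:E n) 4).indicator (fun y => ENNReal.ofReal ((‖y‖^(n-1))⁻¹)) y) ξ]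
    refine lintegral_congr fun y => ?_
    simp only [Set.indicator, mem_ball, dist_eq_norm, sub_zero]
  rw [e1, sph_polar n (by omega) _ (by
    refine Measurable.indicator ?_ isOpen_ball.measurableSet
    fun_prop)]
  have : ∀ᵐ x ∂(sphMeasure n), ∫⁻ r in Set.Ioi (0:ℝ), ENNReal.ofReal (r ^ (n - 1)) *
      (ball (0:E n) 4).indicator (fun y => ENNReal.ofReal ((‖y‖^(n-1))⁻¹)) (r • x) ≤ 4 := by
    filter_upwards [sph_ae n] with x hx
    calc _ = ∫⁻ r in Set.Ioi (0:ℝ), (Set.Ioo (0:ℝ) 4).indicator 1 r := by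
          refine setLIntegral_congr_fun measurableSet_Ioi fun r hr => ?_
          have hr : (0:ℝ) < r := hr
          simp only [Set.indicator, mem_ball, dist_zero_right, norm_smul, hx, mul_one, Real.norm_eq_abs, abs_of_pos hr,
            Set.mem_Ioo, hr, true_and, Pi.one_apply]
          split_ifs
          · rw [← ENNReal.ofReal_mul (by positivity), mul_inv_cancel₀ (by positivity), ENNReal.ofReal_one]
          · simp
      _ ≤ ∫⁻ r, (Set.Ioo (0:ℝ) 4).indicator 1 r := setLIntegral_le_lintegral _ _
      _ = 4 := by
          rw [lintegral_indicator_one measurableSet_Ioo, Real.volume_Ioo]; norm_num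
  refine (lintegral_mono_ae this).trans_lt ?_
  rw [lintegral_const]
  exact ENNReal.mul_lt_top (by simp) (measure_lt_top _ _)

theorem sph_sing (n : ℕ) (hn : 2 ≤ n) (ξ : E n) (hξ : ‖ξ‖ = 1) :
    Integrable (fun x : E n => (‖x - ξ‖^(n-2))⁻¹) (sphMeasure n) := by
  refine ⟨by fun_prop, ?_⟩
  rw [hasFiniteIntegral_iff_ofReal (Eventually.of_forall fun x => by positivity)]
  have h1 := ball_pow_int n hn ξ
  rw [sph_polar n (by omega) _ (by
    refine Measurable.indicator ?_ isOpen_ball.measurableSet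
    fun_prop)] at h1
  have key : ∀ᵐ x ∂(sphMeasure n), ENNReal.ofReal ((‖x - ξ‖^(n-2))⁻¹) ≤ ENNReal.ofReal (4^n) *
      ∫⁻ r in Set.Ioi (0:ℝ), ENNReal.ofReal (r ^ (n - 1)) *
      (ball ξ 4).indicator (fun y => ENNReal.ofReal ((‖y-ξ‖^(n-1))⁻¹)) (r • x) := by
    have hne : ∀ᵐ x ∂(sphMeasure n), x ≠ ξ := by
      rw [ae_iff]; simpa using sph_atom n hn ξ
    filter_upwards [sph_ae n, hne] with x hx hxξ
    obtain ⟨p, rfl⟩ : ∃ p, n = p + 2 := ⟨n - 2, by omega⟩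
    set d := ‖x - ξ‖ with hd
    have hd0 : 0 < d := by rw [hd, norm_pos_iff, sub_ne_zero]; exact hxξ
    have hd2 : d ≤ 2 := by
      calc d ≤ ‖x‖ + ‖ξ‖ := norm_sub_le _ _
        _ = 2 := by rw [hx, hξ]; norm_num
    have step : ∫⁻ r in Set.Ioo (1 - d/4) 1, ENNReal.ofReal ((1/2)^(p+1) * ((2*d)^(p+1))⁻¹) ≤
      ∫⁻ r in Set.Ioi (0:ℝ), ENNReal.ofReal (r ^ (p + 2 - 1)) *
      (ball ξ 4).indicator (fun y => ENNReal.ofReal ((‖y-ξ‖^(p+2-1))⁻¹)) (r • x) := by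
      refine le_trans (setLIntegral_mono' measurableSet_Ioo ?_) (lintegral_mono_set (s := Set.Ioo (1-d/4) 1) ?_)
      · intro r hr
        obtain ⟨hr1, hr2⟩ := hr
        have hb : ‖r • x - ξ‖ ≤ 2 * d - d/2 := by
          calc _ = ‖(x - ξ) + (r - 1) • x‖ := by congr 1; rw [sub_smul, one_smul]; abel
            _ ≤ d + ‖(r-1) • x‖ := norm_add_le _ _
            _ = d + (1 - r) := by rw [norm_smul, hx, Real.norm_eq_abs, abs_of_neg (by linarith)]; ring
            _ ≤ _ := by linarith
        rw [Set.indicator_of_mem, show p + 2 - 1 = p + 1 by omega, ← ENNReal.ofReal_mul (by have : 0 ≤ r := by linarith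
                                                                                            positivity)]
        · refine ENNReal.ofReal_le_ofReal ?_
          have hp : 0 < ‖r • x - ξ‖ := by
            rw [norm_pos_iff, sub_ne_zero]
            intro h
            have := congrArg norm h
            rw [norm_smul, hx, hξ, Real.norm_eq_abs, abs_of_pos (by linarith)] at this
            linarith
          have hr0 : 0 ≤ r := by linarith
          gcongr
          · linarith
          · linarith
        · rw [mem_ball, dist_eq_norm]; linarith
      · intro r hr
        have := hr.1
        simp only [Set.mem_Ioi]; linarith
    calc _ ≤ ENNReal.ofReal (4^(p+2)) * ∫⁻ r in Set.Ioo (1 - d/4) 1, ENNReal.ofReal ((1/2)^(p+1) * ((2*d)^(p+1))⁻¹) := by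
          rw [setLIntegral_const, Real.volume_Ioo, ← ENNReal.ofReal_mul (by positivity), ← ENNReal.ofReal_mul (by positivity)]
          refine ENNReal.ofReal_le_ofReal (le_of_eq ?_)
          rw [show p + 2 - 2 = p by omega, mul_pow, div_pow, pow_succ, pow_succ, pow_succ, pow_succ, show (4:ℝ)^p = 2^p*2^p by rw [← mul_pow]; norm_num]
          field_simp
          ring
      _ ≤ _ := by gcongr
  refine (lintegral_mono_ae key).trans_lt ?_
  rw [lintegral_const_mul' _ _ (by simp)]
  exact ENNReal.mul_lt_top (by simp) h1

theorem sph_cont_int (n : ℕ) (g : E n → ℝ) (hg : Continuous g) : Integrable g (sphMeasure n) := by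
  obtain ⟨C, hC⟩ := (isCompact_closedBall (0 : E n) 1).exists_bound_of_continuousOn hg.continuousOn
  refine Integrable.of_bound hg.aestronglyMeasurable C ?_
  filter_upwards [sph_ae n] with x hx
  exact hC x (by simp [hx])

theorem sph_cont_int2 (n : ℕ) (g : E n × E n → ℝ) (hg : Continuous g) :
    Integrable g ((sphMeasure n).prod (sphMeasure n)) := by
  obtain ⟨C, hC⟩ := ((isCompact_closedBall (0 : E n) 1).prod (isCompact_closedBall (0 : E n) 1)).exists_bound_of_continuousOn hg.continuousOn
  refine Integrable.of_bound hg.aestronglyMeasurable C ?_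
  have h1 : ∀ᵐ z ∂((sphMeasure n).prod (sphMeasure n)), ‖z.1‖ = 1 :=
    Measure.quasiMeasurePreserving_fst.ae (sph_ae n)
  have h2 : ∀ᵐ z ∂((sphMeasure n).prod (sphMeasure n)), ‖z.2‖ = 1 :=
    Measure.quasiMeasurePreserving_snd.ae (sph_ae n)
  filter_upwards [h1, h2] with x hx hy
  exact hC x (by simp [hx, hy])

theorem eval_cont (n : ℕ) (p : MvPolynomial (Fin n) ℝ) : Continuous (fun x : E n => MvPolynomial.eval (fun i => x i) p) := by
  have := MvPolynomial.continuous_eval p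
  exact this.comp (by fun_prop)

theorem sph_int_inv (n : ℕ) (L : E n ≃ₗᵢ[ℝ] E n) (g : E n → ℝ) :
    ∫ x, g (L x) ∂(sphMeasure n) = ∫ x, g x ∂(sphMeasure n) :=
  (sph_inv n L).integral_comp L.toHomeomorph.measurableEmbedding g

def lin (n : ℕ) (v : E n) : MvPolynomial (Fin n) ℝ := ∑ i, MvPolynomial.C (v i) * MvPolynomial.X i

theorem lin_eval (n : ℕ) (v x : E n) : MvPolynomial.eval (fun i => x i) (lin n v) = inner ℝ v x := by
  simp [lin, PiLp.inner_apply, mul_comm]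

theorem lin_deg (n : ℕ) (v : E n) : (lin n v).totalDegree ≤ 1 := by
  refine (MvPolynomial.totalDegree_finsetSum _ _).trans (Finset.sup_le fun i _ => ?_)
  refine (MvPolynomial.totalDegree_mul _ _).trans ?_
  simp

theorem pair_int (n : ℕ) (a b : E n) (ha : ‖a‖ = 1) (hb : ‖b‖ = 1) (hab : inner ℝ a b = 0)
    (c d : E n) (hc : ‖c‖ = 1) (hd : ‖d‖ = 1) (hcd : inner ℝ c d = 0) (F : ℝ → ℝ → ℝ) :
    ∫ x, F (inner ℝ c x) (inner ℝ d x) ∂(sphMeasure n) = ∫ x, F (inner ℝ a x) (inner ℝ b x) ∂(sphMeasure n) := by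
  obtain ⟨L, h1, h2⟩ := exists_isom_pair n a b c d ha hb hab hc hd hcd
  rw [← sph_int_inv n L]
  simp only [← h1, ← h2, LinearIsometryEquiv.inner_map_map]

theorem T_pow (n : ℕ) (hn : 2 ≤ n) (k : ℝ → ℝ) (hk : Continuous k) (v : E n) (d : ℕ) :
    ∃ P : MvPolynomial (Fin n) ℝ, P.totalDegree ≤ d ∧ ∀ ξ : E n, ‖ξ‖ = 1 →
      MvPolynomial.eval (fun i => ξ i) P = ∫ x, (inner ℝ v x)^d * k (inner ℝ ξ x) ∂(sphMeasure n) := by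
  obtain ⟨a, ha⟩ : ∃ a : E n, ‖a‖ = 1 := ⟨EuclideanSpace.single ⟨0, by omega⟩ 1, by simp⟩
  obtain ⟨b, hb, hab⟩ := exists_orth n hn a ha
  let c : ℕ → ℝ := fun j => ∫ x, (inner ℝ a x)^(d-j) * (inner ℝ b x)^j * k (inner ℝ a x) ∂(sphMeasure n)
  have hodd : ∀ j, Odd j → c j = 0 := by
    intro j hj
    have := pair_int n a b ha hb hab a (-b) ha (by simpa using hb) (by simpa using hab) (fun s t => s^(d-j) * t^j * k s)
    simp only [inner_neg_left, hj.neg_pow] at this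
    have h2 : -c j = c j := by
      simp only [c]
      rw [← integral_neg, ← this]
      congr 1; ext x; ring
    linarith
  have hcj : ∀ (ξ w : E n), ‖ξ‖ = 1 → inner ℝ ξ w = 0 → ∀ j,
      ∫ x, (inner ℝ ξ x)^(d-j) * (inner ℝ w x)^j * k (inner ℝ ξ x) ∂(sphMeasure n) = ‖w‖^j * c j := by
    intro ξ w hξ hw j
    obtain ⟨b', hb', hξb, hwb⟩ : ∃ b' : E n, ‖b'‖ = 1 ∧ inner ℝ ξ b' = 0 ∧ w = ‖w‖ • b' := by
      by_cases h0 : w = 0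
      · obtain ⟨b', h1, h2⟩ := exists_orth n hn ξ hξ
        exact ⟨b', h1, h2, by simp [h0]⟩
      · have h1 : ‖w‖ ≠ 0 := by simpa using h0
        refine ⟨‖w‖⁻¹ • w, ?_, ?_, ?_⟩
        · rw [norm_smul, norm_inv, norm_norm, inv_mul_cancel₀ h1]
        · rw [inner_smul_right, hw, mul_zero]
        · rw [smul_smul, mul_inv_cancel₀ h1, one_smul]
    have := pair_int n a b ha hb hab ξ b' hξ hb' hξb (fun s t => s^(d-j) * t^j * k s)
    simp only [c]
    rw [← this, ← integral_const_mul]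
    congr 1; ext x
    conv_lhs => rw [hwb, inner_smul_left]
    simp
    ring
  refine ⟨∑ j ∈ Finset.range (d+1), if Even j then MvPolynomial.C (d.choose j * c j) *
      (lin n v)^(d-j) * (MvPolynomial.C (‖v‖^2) - (lin n v)^2)^(j/2) else 0, ?_, ?_⟩
  · refine (MvPolynomial.totalDegree_finsetSum _ _).trans (Finset.sup_le fun j hj => ?_)
    have hj : j < d + 1 := Finset.mem_range.1 hj
    split_ifs with he
    · obtain ⟨i, rfl⟩ := he
      have hl := lin_deg n v
      have h1 : ((lin n v)^(d-(i+i))).totalDegree ≤ d - (i+i) := by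
        refine (MvPolynomial.totalDegree_pow _ _).trans ?_
        nlinarith
      have h2 : (MvPolynomial.C (‖v‖^2) - (lin n v)^2).totalDegree ≤ 2 := by
        refine (MvPolynomial.totalDegree_sub _ _).trans ?_
        refine max_le (by rw [MvPolynomial.totalDegree_C]; omega) ((MvPolynomial.totalDegree_pow _ _).trans (by omega))
      have h3 : ((MvPolynomial.C (‖v‖^2) - (lin n v)^2)^((i+i)/2)).totalDegree ≤ i + i := by
        refine (MvPolynomial.totalDegree_pow _ _).trans ?_
        have : (i + i)/2 = i := by omega
        rw [this]
        nlinarith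
      refine (MvPolynomial.totalDegree_mul _ _).trans ?_
      have h4 : (MvPolynomial.C (d.choose (i+i) * c (i+i)) * (lin n v)^(d-(i+i))).totalDegree ≤ d - (i+i) := by
        refine (MvPolynomial.totalDegree_mul _ _).trans ?_
        rw [MvPolynomial.totalDegree_C]; omega
      omega
    · simp
  · intro ξ hξ
    set α := inner ℝ v ξ with hα
    set w := v - α • ξ with hw
    have hv : v = α • ξ + w := by rw [hw]; abel
    have hξξ : inner ℝ ξ ξ = 1 := by rw [real_inner_self_eq_norm_sq, hξ]; norm_num
    have hwξ : inner ℝ ξ w = 0 := by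
      rw [hw, inner_sub_right, inner_smul_right, hξξ, real_inner_comm ]; simp [hα]
    have hwn : ‖w‖^2 = ‖v‖^2 - α^2 := by
      have : ‖v‖^2 = α^2 + ‖w‖^2 := by
        rw [hv, norm_add_sq_real, inner_smul_left, hwξ, norm_smul, hξ]; simp
      linarith
    have e1 : ∀ x : E n, (inner ℝ v x)^d * k (inner ℝ ξ x) = ∑ j ∈ Finset.range (d+1),
        (d.choose j * α^(d-j)) * ((inner ℝ ξ x)^(d-j) * (inner ℝ w x)^j * k (inner ℝ ξ x)) := by
      intro x
      conv_lhs => rw [hv, inner_add_left, inner_smul_left, add_comm, add_pow, Finset.sum_mul]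
      refine Finset.sum_congr rfl fun j _ => ?_
      simp [mul_pow]; ring
    simp only [e1]
    rw [integral_finsetSum _ (fun j _ => sph_cont_int n _ (by fun_prop)), map_sum]
    refine Finset.sum_congr rfl fun j _ => ?_
    rw [integral_const_mul, hcj ξ w hξ hwξ j]
    split_ifs with he
    · obtain ⟨i, rfl⟩ := he
      simp only [map_mul, map_pow, map_sub, MvPolynomial.eval_C, lin_eval]
      rw [← hα, ← hwn, show (i+i)/2 = i by omega, ← pow_mul]; ring
    · rw [hodd j (Nat.not_even_iff_odd.1 he)]; simp

theorem mono_span (n d : ℕ) (s : Fin n →₀ ℕ) (hs : ∑ i, s i = d) :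
    MvPolynomial.monomial s (1:ℝ) ∈ Submodule.span ℝ (Set.range fun v : E n => (lin n v)^d) := by
  by_contra hc
  obtain ⟨φ, hφ, hφ2⟩ := Submodule.exists_le_ker_of_notMem hc
  apply hφ
  let Q : MvPolynomial (Fin n) ℝ := ∑ k ∈ Finset.piAntidiag Finset.univ d,
    MvPolynomial.monomial (Finsupp.equivFunOnFinite.symm k) (Nat.multinomial Finset.univ k * φ (MvPolynomial.monomial (Finsupp.equivFunOnFinite.symm k) 1))
  have hQ : Q = 0 := by
    refine MvPolynomial.funext fun v => ?_
    have h1 : (lin n (WithLp.toLp 2 v))^d = ∑ k ∈ Finset.piAntidiag Finset.univ d,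
        (Nat.multinomial Finset.univ k * ∏ i, v i ^ k i) • MvPolynomial.monomial (Finsupp.equivFunOnFinite.symm k) (1:ℝ) := by
      rw [lin, Finset.sum_pow_eq_sum_piAntidiag]
      refine Finset.sum_congr rfl fun k _ => ?_
      rw [MvPolynomial.smul_monomial, MvPolynomial.monomial_eq, Finsupp.prod_fintype _ _ (by simp)]
      simp only [mul_pow, Finset.prod_mul_distrib]
      simp [mul_assoc]
    have h2 : φ ((lin n (WithLp.toLp 2 v))^d) = 0 := hφ2 (Submodule.subset_span ⟨_, rfl⟩)
    rw [h1, map_sum] at h2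
    rw [map_zero, ← h2]
    simp only [Q, map_sum]
    refine Finset.sum_congr rfl fun k _ => ?_
    rw [map_smul, MvPolynomial.eval_monomial, Finsupp.prod_fintype _ _ (by simp)]
    simp; ring
  have h3 : MvPolynomial.coeff s Q = 0 := by rw [hQ]; simp
  simp only [Q, MvPolynomial.coeff_sum, MvPolynomial.coeff_monomial] at h3
  rw [Finset.sum_eq_single (s : Fin n → ℕ)] at h3
  · have h4 : Finsupp.equivFunOnFinite.symm (s : Fin n → ℕ) = s := by simp
    rw [h4] at h3
    simp only [if_true] at h3
    rcases mul_eq_zero.1 h3 with h | h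
    · exact absurd h (by exact_mod_cast (Nat.multinomial_pos _ _).ne')
    · exact h
  · intro k _ hk
    rw [if_neg]
    rintro rfl
    exact hk (by simp)
  · intro h
    exact absurd (by simp [hs]) h

theorem T_deg (n : ℕ) (hn : 2 ≤ n) (k : ℝ → ℝ) (hk : Continuous k) (m : ℕ) (p : MvPolynomial (Fin n) ℝ) (hp : p.totalDegree ≤ m) :
    ∃ P : MvPolynomial (Fin n) ℝ, P.totalDegree ≤ m ∧ ∀ ξ : E n, ‖ξ‖ = 1 →
      MvPolynomial.eval (fun i => ξ i) P = ∫ x, MvPolynomial.eval (fun i => x i) p * k (inner ℝ ξ x) ∂(sphMeasure n) := by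
  let W : Submodule ℝ (MvPolynomial (Fin n) ℝ) :=
    { carrier := {p | ∃ P : MvPolynomial (Fin n) ℝ, P.totalDegree ≤ m ∧ ∀ ξ : E n, ‖ξ‖ = 1 →
      MvPolynomial.eval (fun i => ξ i) P = ∫ x, MvPolynomial.eval (fun i => x i) p * k (inner ℝ ξ x) ∂(sphMeasure n)}
      zero_mem' := ⟨0, by simp, by simp⟩
      add_mem' := by
        rintro p q ⟨P, h1, h2⟩ ⟨Q, h3, h4⟩
        refine ⟨P + Q, (MvPolynomial.totalDegree_add _ _).trans (max_le h1 h3), fun ξ hξ => ?_⟩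
        simp only [map_add, add_mul]
        rw [h2 ξ hξ, h4 ξ hξ, integral_add]
        · exact sph_cont_int n _ ((eval_cont n p).mul (by fun_prop))
        · exact sph_cont_int n _ ((eval_cont n q).mul (by fun_prop))
      smul_mem' := by
        rintro c p ⟨P, h1, h2⟩
        refine ⟨c • P, (MvPolynomial.totalDegree_smul_le _ _).trans h1, fun ξ hξ => ?_⟩
        simp only [MvPolynomial.smul_eval, mul_assoc]
        rw [h2 ξ hξ, integral_const_mul] }
  change p ∈ W
  rw [p.as_sum]
  refine Submodule.sum_mem _ fun s hs => ?_
  have hsm : ∑ i, s i ≤ m := by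
    have := MvPolynomial.le_totalDegree hs
    rw [Finsupp.sum_fintype _ _ (by simp)] at this
    omega
  have h1 : MvPolynomial.monomial s (p.coeff s) = p.coeff s • MvPolynomial.monomial s (1:ℝ) := by
    rw [MvPolynomial.smul_monomial]; simp
  rw [h1]
  refine Submodule.smul_mem _ _ ?_
  refine (Submodule.span_le.2 ?_) (mono_span n (∑ i, s i) s rfl)
  rintro _ ⟨v, rfl⟩
  obtain ⟨P, hP, hP2⟩ := T_pow n hn k hk v (∑ i, s i)
  refine ⟨P, hP.trans hsm, fun ξ hξ => ?_⟩
  rw [hP2 ξ hξ]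
  simp only [map_pow, lin_eval]

theorem T_lemma (n : ℕ) (hn : 2 ≤ n) (k : ℝ → ℝ) (hk : Continuous k) (m : ℕ) (p : MvPolynomial (Fin n) ℝ) (hp : p ∈ P0 n m) :
    ∃ P ∈ P0 n m, ∀ ξ : E n, ‖ξ‖ = 1 →
      MvPolynomial.eval (fun i => ξ i) P = ∫ x, MvPolynomial.eval (fun i => x i) p * k (inner ℝ ξ x) ∂(sphMeasure n) := by
  obtain ⟨P, h1, h2⟩ := T_deg n hn k hk m p hp.1
  refine ⟨P, ⟨h1, ?_⟩, h2⟩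
  have e1 : ∫ ξ, MvPolynomial.eval (fun i => ξ i) P ∂(sphMeasure n) =
      ∫ ξ, ∫ x, MvPolynomial.eval (fun i => x i) p * k (inner ℝ ξ x) ∂(sphMeasure n) ∂(sphMeasure n) := by
    refine integral_congr_ae ?_
    filter_upwards [sph_ae n] with ξ hξ
    exact h2 ξ hξ
  rw [e1, integral_integral_swap]
  · obtain ⟨a, ha⟩ : ∃ a : E n, ‖a‖ = 1 := ⟨EuclideanSpace.single ⟨0, by omega⟩ 1, by simp⟩
    have e2 : ∀ᵐ x ∂(sphMeasure n), ∫ ξ, MvPolynomial.eval (fun i => x i) p * k (inner ℝ ξ x) ∂(sphMeasure n) =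
       MvPolynomial.eval (fun i => x i) p * ∫ ξ, k (inner ℝ ξ a) ∂(sphMeasure n) := by
      filter_upwards [sph_ae n] with x hx
      rw [integral_const_mul]
      congr 1
      obtain ⟨L, hL⟩ := exists_isom n hn a x ha hx
      rw [← sph_int_inv n L]
      simp only [← hL, LinearIsometryEquiv.inner_map_map]
    rw [integral_congr_ae e2, integral_mul_const, hp.2, zero_mul]
  · exact sph_cont_int2 n _ (((eval_cont n p).comp continuous_snd).mul (by fun_prop))

theorem hull_image {V : Type*} [NormedAddCommGroup V] [NormedSpace ℝ V] [FiniteDimensional ℝ V]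
    (K : Set V) (hne : K.Nonempty) (y : V) (hy : y ∈ convexHull ℝ K) :
    ∃ (z : Fin (Module.finrank ℝ V + 1) → V) (c : Fin (Module.finrank ℝ V + 1) → ℝ), (∀ i, z i ∈ K) ∧ (∀ i, 0 ≤ c i) ∧
      ∑ i, c i = 1 ∧ ∑ i, c i • z i = y := by
  obtain ⟨x0, hx0⟩ := hne
  obtain ⟨ι, _, z, w, hz, haff, hw, hw1, hwy⟩ := eq_pos_convex_span_of_mem_convexHull hy
  have hcard : Fintype.card ι ≤ Module.finrank ℝ V + 1 := by
    have := haff.card_le_finrank_succ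
    have h2 := Submodule.finrank_le (vectorSpan ℝ (Set.range z))
    omega
  obtain ⟨f⟩ : Nonempty (ι ↪ Fin (Module.finrank ℝ V + 1)) := by
    rw [Function.Embedding.nonempty_iff_card_le]; simpa using hcard
  refine ⟨Function.extend f z (fun _ => x0), Function.extend f w (fun _ => 0), ?_, ?_, ?_, ?_⟩
  · intro i
    by_cases h : ∃ j, f j = i
    · obtain ⟨j, rfl⟩ := h
      rw [f.injective.extend_apply]; exact hz ⟨j, rfl⟩
    · rw [Function.extend_apply' _ _ _ h]; exact hx0
  · intro i
    by_cases h : ∃ j, f j = i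
    · obtain ⟨j, rfl⟩ := h
      rw [f.injective.extend_apply]; exact (hw j).le
    · rw [Function.extend_apply' _ _ _ h]
  · rw [← hw1]
    symm
    refine Finset.sum_of_injOn f f.injective.injOn (by simp) ?_ ?_
    · intro i _ hi
      rw [Function.extend_apply']
      simpa using hi
    · intro i _
      rw [f.injective.extend_apply]
  · rw [← hwy]
    symm
    refine Finset.sum_of_injOn f f.injective.injOn (by simp) ?_ ?_
    · intro i _ hi
      rw [Function.extend_apply' w, zero_smul]
      simpa using hi
    · intro i _
      rw [f.injective.extend_apply, f.injective.extend_apply]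

theorem hull_compact {V : Type*} [NormedAddCommGroup V] [NormedSpace ℝ V] [FiniteDimensional ℝ V]
    (K : Set V) (hK : IsCompact K) : IsCompact (convexHull ℝ K) := by
  rcases K.eq_empty_or_nonempty with rfl | hne
  · simp
  have h1 : convexHull ℝ K = (fun p : (Fin (Module.finrank ℝ V + 1) → ℝ) × (Fin (Module.finrank ℝ V + 1) → V) => ∑ i, p.1 i • p.2 i) ''
      (stdSimplex ℝ (Fin (Module.finrank ℝ V + 1)) ×ˢ (Set.univ.pi fun _ => K)) := by
    ext y
    constructor
    · intro hy
      obtain ⟨z, c, h1, h2, h3, h4⟩ := hull_image K hne y hy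
      exact ⟨(c, z), ⟨⟨h2, h3⟩, fun i _ => h1 i⟩, h4⟩
    · rintro ⟨⟨c, z⟩, ⟨⟨h2, h3⟩, h1⟩, rfl⟩
      refine (convex_convexHull ℝ K).sum_mem (fun i _ => h2 i) h3 (fun i _ => subset_convexHull ℝ K (h1 i trivial))
  rw [h1]
  refine ((isCompact_stdSimplex _ _).prod (isCompact_univ_pi fun _ => hK)).image ?_
  fun_prop

def mon (n m : ℕ) (x : E n) : (Fin n → Fin (m+1)) → ℝ := fun s => ∏ i, x i ^ (s i : ℕ)

theorem mon_cont (n m : ℕ) : Continuous (mon n m) := by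
  unfold mon; fun_prop

def ell (n m : ℕ) (p : MvPolynomial (Fin n) ℝ) : ((Fin n → Fin (m+1)) → ℝ) →ₗ[ℝ] ℝ :=
  ∑ s ∈ p.support, p.coeff s • LinearMap.proj (fun i => Fin.ofNat (m+1) (s i))

theorem ell_mon (n m : ℕ) (p : MvPolynomial (Fin n) ℝ) (hp : p.totalDegree ≤ m) (x : E n) :
    ell n m p (mon n m x) = MvPolynomial.eval (fun i => x i) p := by
  rw [MvPolynomial.eval_eq']
  simp only [ell, LinearMap.sum_apply, LinearMap.smul_apply, LinearMap.proj_apply, mon, smul_eq_mul]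
  refine Finset.sum_congr rfl fun s hs => ?_
  congr 1
  refine Finset.prod_congr rfl fun i _ => ?_
  congr 1
  have := MvPolynomial.le_totalDegree hs
  rw [Finsupp.sum_fintype _ _ (by simp)] at this
  have h2 : s i ≤ ∑ i, s i := Finset.single_le_sum (fun _ _ => Nat.zero_le _) (Finset.mem_univ i)
  simp only [Fin.val_ofNat]
  exact Nat.mod_eq_of_lt (by omega)

def Dd (n m : ℕ) : ℕ := Module.finrank ℝ ((Fin n → Fin (m+1)) → ℝ) + 1

theorem repr_hull (n m : ℕ) (hn : 2 ≤ n) (y : (Fin n → Fin (m+1)) → ℝ)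
    (hy : y ∈ closure (convexHull ℝ (mon n m '' sphere (0:E n) 1))) :
    ∃ (z : Fin (Dd n m) → E n) (c : Fin (Dd n m) → ℝ), (∀ i, ‖z i‖ = 1) ∧ (∀ i, 0 ≤ c i) ∧
      ∑ i, c i = 1 ∧ ∑ i, c i • mon n m (z i) = y := by
  have hK : IsCompact (mon n m '' sphere (0:E n) 1) := (isCompact_sphere _ _).image (mon_cont n m)
  rw [(hull_compact _ hK).isClosed.closure_eq] at hy
  have hne : (mon n m '' sphere (0:E n) 1).Nonempty := by
    refine Set.Nonempty.image _ ⟨EuclideanSpace.single ⟨0, by omega⟩ 1, by simp⟩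
  obtain ⟨z, c, h1, h2, h3, h4⟩ := hull_image _ hne y hy
  choose z' h5 h6 using h1
  exact ⟨z', c, fun i => by simpa using h5 i, h2, h3, by
    have h7 : ∀ i, c i • mon n m (z' i) = c i • z i := fun i => by rw [h6 i]
    exact (Finset.sum_congr rfl fun i _ => h7 i).trans h4⟩

/-- finite admissible families -/
def FinGood (n m : ℕ) (ι : Type) [Fintype ι] (z : ι → E n) (c : ι → ℝ) : Prop :=
  (∀ i, ‖z i‖ = 1) ∧ (∀ i, 0 ≤ c i) ∧ ∑ i, c i = 1 ∧ ∀ p ∈ P0 n m, ∑ i, c i * MvPolynomial.eval (fun j => z i j) p = 0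

theorem ell_sum (n m : ℕ) (ι : Type) [Fintype ι] (z : ι → E n) (c : ι → ℝ) (p : MvPolynomial (Fin n) ℝ) (hp : p.totalDegree ≤ m) :
    ∑ i, c i * MvPolynomial.eval (fun j => z i j) p = ell n m p (∑ i, c i • mon n m (z i)) := by
  simp [map_sum, ell_mon n m p hp]

theorem exists_finGood (n m : ℕ) (hn : 2 ≤ n) : ∃ (z : Fin (Dd n m) → E n) (c : Fin (Dd n m) → ℝ), FinGood n m _ z c := by
  have hSA := SA_pos n (by omega)
  have : NeZero (sphMeasure n) := ⟨by
    intro h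
    rw [SA, h] at hSA; simp at hSA⟩
  have hIntg : Integrable (mon n m) (sphMeasure n) := by
    obtain ⟨C, hC⟩ := (isCompact_closedBall (0 : E n) 1).exists_bound_of_continuousOn (mon_cont n m).continuousOn
    refine Integrable.of_bound (mon_cont n m).aestronglyMeasurable C ?_
    filter_upwards [sph_ae n] with x hx
    exact hC x (by simp [hx])
  have hy : ⨍ x, mon n m x ∂(sphMeasure n) ∈ closure (convexHull ℝ (mon n m '' sphere (0:E n) 1)) := by
    refine (convex_convexHull ℝ _).closure.average_mem isClosed_closure ?_ hIntg
    filter_upwards [sph_ae n] with x hx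
    exact subset_closure (subset_convexHull ℝ _ ⟨x, by simpa using hx, rfl⟩)
  obtain ⟨z, c, h1, h2, h3, h4⟩ := repr_hull n m hn _ hy
  refine ⟨z, c, h1, h2, h3, fun p hp => ?_⟩
  rw [ell_sum n m _ _ _ _ hp.1, h4, average_eq, map_smul]
  have : ell n m p (∫ x, mon n m x ∂(sphMeasure n)) = ∫ x, MvPolynomial.eval (fun i => x i) p ∂(sphMeasure n) := by
    have := (LinearMap.toContinuousLinearMap (ell n m p)).integral_comp_comm hIntg
    simp only [LinearMap.coe_toContinuousLinearMap', ell_mon n m p hp.1] at this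
    exact this.symm
  rw [this, hp.2, smul_zero]

theorem tsum_mem_hull (n m : ℕ) (ξ : ℕ → E n) (hξ : ∀ i, ‖ξ i‖ = 1) (c : ℕ → ℝ) (hc : ∀ i, 0 ≤ c i) (hs : HasSum c 1)
    (y : (Fin n → Fin (m+1)) → ℝ) (hy : HasSum (fun i => c i • mon n m (ξ i)) y) :
    y ∈ closure (convexHull ℝ (mon n m '' sphere (0:E n) 1)) := by
  have h1 : Tendsto (fun s : Finset ℕ => s.centerMass c (fun i => mon n m (ξ i))) atTop (nhds y) := by
    unfold Finset.centerMass
    have := (Tendsto.inv₀ hs one_ne_zero).smul hy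
    simpa using this
  refine mem_closure_of_tendsto h1 ?_
  have h2 : ∀ᶠ s : Finset ℕ in atTop, 0 < ∑ i ∈ s, c i := hs.eventually (lt_mem_nhds one_pos)
  filter_upwards [h2] with s h
  refine Finset.centerMass_mem_convexHull _ (fun i _ => hc i) h (fun i _ => ⟨ξ i, by simpa using hξ i, rfl⟩)

theorem reduce_fin (n m : ℕ) (hn : 2 ≤ n) (θ : ℝ) (hθ : 0 < θ) (ξ : ℕ → E n) (w : ℕ → ℝ) (hξ : ∀ i, ‖ξ i‖ = 1) (hw : ∀ i, 0 ≤ w i)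
    (hs : Summable w) (hs1 : ∑' i, w i = 1) (hp : ∀ p ∈ P0 n m, (∑' i, w i * MvPolynomial.eval (fun j => ξ i j) p) = 0)
    (hsθ : Summable (fun i => w i ^ θ)) (ε : ℝ) (hε : 0 < ε) :
    ∃ (N : ℕ) (z : Fin N ⊕ Fin (Dd n m) → E n) (c : Fin N ⊕ Fin (Dd n m) → ℝ), FinGood n m _ z c ∧ ∑ i, c i ^ θ ≤ ∑' i, w i ^ θ + ε := by
  obtain ⟨C, hC⟩ := (isCompact_closedBall (0 : E n) 1).exists_bound_of_continuousOn (mon_cont n m).continuousOn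
  have hC' : ∀ i, ‖mon n m (ξ i)‖ ≤ C := fun i => hC _ (by simp [hξ i])
  have hsm : Summable (fun i => w i • mon n m (ξ i)) := by
    refine Summable.of_norm_bounded (hs.mul_right C) fun i => ?_
    rw [norm_smul, Real.norm_eq_abs, abs_of_nonneg (hw i)]
    exact mul_le_mul_of_nonneg_left (hC' i) (hw i)
  have htail : Tendsto (fun N => (Dd n m : ℝ) * (∑' i, w (i + N)) ^ θ) atTop (nhds 0) := by
    have := ((tendsto_sum_nat_add w).rpow_const (p := θ) (Or.inr hθ.le)).const_mul (Dd n m : ℝ)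
    simpa [Real.zero_rpow hθ.ne'] using this
  obtain ⟨N, hN⟩ := (htail.eventually (gt_mem_nhds hε)).exists
  set T := ∑' i, w (i + N) with hT
  have hT0 : 0 ≤ T := tsum_nonneg fun i => hw _
  have hsN : Summable (fun i => w (i + N)) := (summable_nat_add_iff N).2 hs
  have hsmN : Summable (fun i => w (i + N) • mon n m (ξ (i + N))) := (summable_nat_add_iff (f := fun i => w i • mon n m (ξ i)) N).2 hsm
  obtain ⟨z, c, h1, h2, h3, h4⟩ : ∃ (z : Fin (Dd n m) → E n) (c : Fin (Dd n m) → ℝ), (∀ i, ‖z i‖ = 1) ∧ (∀ i, 0 ≤ c i) ∧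
      ∑ i, c i = 1 ∧ T • ∑ i, c i • mon n m (z i) = ∑' i, w (i + N) • mon n m (ξ (i + N)) := by
    rcases hT0.eq_or_lt with h0 | h0
    · obtain ⟨z, c, h1, h2, h3, _⟩ := exists_finGood n m hn
      refine ⟨z, c, h1, h2, h3, ?_⟩
      have : ∀ i, w (i + N) = 0 := by
        have := (hasSum_zero_iff_of_nonneg (fun i => hw (i + N))).1 (by rw [h0]; exact hsN.hasSum)
        exact fun i => congrFun this i
      simp [this, ← h0]
    · obtain ⟨z, c, h1, h2, h3, h4⟩ := repr_hull n m hn (T⁻¹ • ∑' i, w (i + N) • mon n m (ξ (i + N))) (by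
        refine tsum_mem_hull n m (fun i => ξ (i + N)) (fun i => hξ _) (fun i => T⁻¹ * w (i + N)) (fun i => mul_nonneg (by positivity) (hw _)) ?_ _ ?_
        · have := hsN.hasSum.mul_left T⁻¹
          rwa [← hT, inv_mul_cancel₀ h0.ne'] at this
        · simp only [mul_smul]
          exact hsmN.hasSum.const_smul _)
      exact ⟨z, c, h1, h2, h3, by rw [h4, smul_smul, mul_inv_cancel₀ h0.ne', one_smul]⟩
  refine ⟨N, Sum.elim (fun i => ξ i) z, Sum.elim (fun i => w i) (fun i => T * c i), ⟨?_, ?_, ?_, ?_⟩, ?_⟩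
  · rintro (i | i)
    · exact hξ i
    · exact h1 i
  · rintro (i | i)
    · exact hw i
    · exact mul_nonneg hT0 (h2 i)
  · simp only [Fintype.sum_sum_type, Sum.elim_inl, Sum.elim_inr]
    rw [← Finset.mul_sum, h3, mul_one, Fin.sum_univ_eq_sum_range (fun i => w i), ← hs1, hT, hs.sum_add_tsum_nat_add]
  · intro p hp0
    rw [ell_sum n m _ _ _ _ hp0.1]
    simp only [Fintype.sum_sum_type, Sum.elim_inl, Sum.elim_inr, mul_smul]
    rw [← Finset.smul_sum, h4, Fin.sum_univ_eq_sum_range (fun i => w i • mon n m (ξ i)), hsm.sum_add_tsum_nat_add N,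
      ← hp p hp0]
    have := (LinearMap.toContinuousLinearMap (ell n m p)).map_tsum hsm
    simp only [LinearMap.coe_toContinuousLinearMap', map_smul, ell_mon n m p hp0.1, smul_eq_mul] at this
    exact this
  · simp only [Fintype.sum_sum_type, Sum.elim_inl, Sum.elim_inr]
    rw [Fin.sum_univ_eq_sum_range (fun i => w i ^ θ)]
    have k1 : ∑ i ∈ Finset.range N, w i ^ θ ≤ ∑' i, w i ^ θ := hsθ.sum_le_tsum _ (fun i _ => Real.rpow_nonneg (hw i) _)
    have k2 : ∑ i, (T * c i)^θ ≤ ∑ i : Fin (Dd n m), T ^ θ := by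
      refine Finset.sum_le_sum fun i _ => Real.rpow_le_rpow (mul_nonneg hT0 (h2 i)) ?_ hθ.le
      have : c i ≤ 1 := h3 ▸ Finset.single_le_sum (fun j _ => h2 j) (Finset.mem_univ i)
      exact mul_le_of_le_one_right hT0 this
    simp at k2
    linarith

theorem rpow_sum_le {ι : Type} (s : Finset ι) (c : ι → ℝ) (hc : ∀ i, 0 ≤ c i) (θ : ℝ) (hθ : 0 < θ) (hθ1 : θ ≤ 1) :
    (∑ i ∈ s, c i) ^ θ ≤ ∑ i ∈ s, c i ^ θ := by
  classical
  induction s using Finset.induction_on with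
  | empty => simp [Real.zero_rpow hθ.ne']
  | insert a s ha ih =>
    rw [Finset.sum_insert ha, Finset.sum_insert ha]
    exact (Real.rpow_add_le_add_rpow (hc a) (Finset.sum_nonneg fun i _ => hc i) hθ.le hθ1).trans (by gcongr)

/-- merge to distinct points -/
theorem merge_fin (n m : ℕ) (θ : ℝ) (hθ : 0 < θ) (hθ1 : θ ≤ 1) (ι : Type) [Fintype ι] (z : ι → E n) (c : ι → ℝ) (h : FinGood n m ι z c) :
    ∃ (S : Finset (E n)) (W : E n → ℝ), FinGood n m S (fun x => x.1) (fun x => W x.1) ∧ ∑ x : S, W x.1 ^ θ ≤ ∑ i, c i ^ θ := by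
  classical
  obtain ⟨h1, h2, h3, h4⟩ := h
  refine ⟨Finset.univ.image z, fun x => ∑ i with z i = x, c i, ⟨?_, ?_, ?_, ?_⟩, ?_⟩
  · rintro ⟨x, hx⟩
    obtain ⟨i, _, rfl⟩ := Finset.mem_image.1 hx
    exact h1 i
  · exact fun x => Finset.sum_nonneg fun i _ => h2 i
  · rw [Finset.sum_coe_sort (Finset.univ.image z) (fun x => ∑ i with z i = x, c i), Finset.sum_fiberwise_of_maps_to (by simp)]
    exact h3
  · intro p hp
    rw [Finset.sum_coe_sort (Finset.univ.image z) (fun x => (∑ i with z i = x, c i) * MvPolynomial.eval (fun j => x j) p), ← h4 p hp,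
      ← Finset.sum_fiberwise_of_maps_to (g := z) (t := Finset.univ.image z) (by simp)]
    refine Finset.sum_congr rfl fun x _ => ?_
    rw [Finset.sum_mul]
    refine Finset.sum_congr rfl fun i hi => ?_
    rw [(Finset.mem_filter.1 hi).2]
  · rw [Finset.sum_coe_sort (Finset.univ.image z) (fun x => (∑ i with z i = x, c i)^θ),
      ← Finset.sum_fiberwise_of_maps_to (g := z) (s := Finset.univ) (t := Finset.univ.image z) (by simp)]
    exact Finset.sum_le_sum fun x _ => rpow_sum_le _ _ h2 θ hθ hθ1

theorem final_red (n m : ℕ) (hn : 2 ≤ n) (θ : ℝ) (hθ : 0 < θ) (hθ1 : θ ≤ 1) (α a : ℝ)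
    (H : ∀ (S : Finset (E n)) (W : E n → ℝ), FinGood n m S (fun x => x.1) (fun x => W x.1) → 0 < a ∧ α ≤ a * ∑ x : S, W x.1 ^ θ) (hα : 0 < α) :
    α / Theta n m θ ≤ a := by
  have ha : 0 < a := by
    obtain ⟨z, c, h⟩ := exists_finGood n m hn
    obtain ⟨S, W, h, _⟩ := merge_fin n m θ hθ hθ1 _ z c h
    exact (H S W h).1
  have key : α / a ≤ Theta n m θ ∨ Theta n m θ = 0 := by
    unfold Theta
    by_cases hne : ({t : ℝ | ∃ (ξ : ℕ → E n) (w : ℕ → ℝ),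
    (∀ i, ξ i ∈ Metric.sphere (0 : E n) 1) ∧ (∀ i, 0 ≤ w i) ∧ Summable w ∧
    (∑' i, w i) = 1 ∧
    (∀ p ∈ P0 n m, (∑' i, w i * MvPolynomial.eval (fun j => ξ i j) p) = 0) ∧
    Summable (fun i => w i ^ θ) ∧ t = ∑' i, w i ^ θ}).Nonempty
    · left
      refine le_csInf hne ?_
      rintro t ⟨ξ, w, h1, h2, h3, h4, h5, h6, rfl⟩
      refine le_of_forall_pos_le_add fun ε hε => ?_
      obtain ⟨N, z, c, hg, hle⟩ := reduce_fin n m hn θ hθ ξ w (fun i => by simpa using h1 i) h2 h3 h4 h5 h6 ε hε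
      obtain ⟨S, W, hg2, hle2⟩ := merge_fin n m θ hθ hθ1 _ z c hg
      rw [div_le_iff₀' ha]
      refine (H S W hg2).2.trans ?_
      exact mul_le_mul_of_nonneg_left (hle2.trans hle) ha.le
    · right
      rw [Set.not_nonempty_iff_eq_empty.1 hne, Real.sInf_empty]
  rcases key with h | h
  · have : 0 < α / a := by positivity
    rw [div_le_iff₀ (by linarith)]
    rwa [div_le_iff₀' ha] at h
  · rw [h, div_zero]; exact ha.le

structure HasLap (n : ℕ) (u : E n → ℝ) (x : E n) (g : E n) (L : ℝ) : Prop where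
  smooth : ContDiffAt ℝ 2 u x
  grad : fderiv ℝ u x = innerSL ℝ g
  lapl : lap n u x = L

theorem pd_diff {n : ℕ} {u : E n → ℝ} {x : E n} (h : ContDiffAt ℝ 2 u x) (e : E n) :
    DifferentiableAt ℝ (fun y => fderiv ℝ u y e) x := by
  have h1 : ContDiffAt ℝ 1 (fderiv ℝ u) x := h.fderiv_right (by norm_num)
  exact (h1.differentiableAt (by norm_num)).clm_apply (differentiableAt_const e)

theorem ev_diff {n : ℕ} {u : E n → ℝ} {x : E n} (h : ContDiffAt ℝ 2 u x) : ∀ᶠ y in nhds x, DifferentiableAt ℝ u y := by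
  filter_upwards [h.eventually (by simp)] with y hy
  exact hy.differentiableAt (by norm_num)

theorem HasLap.of_smooth {n : ℕ} {u : E n → ℝ} {x : E n} (h : ContDiffAt ℝ 2 u x) : HasLap n u x (gradient u x) (lap n u x) := by
  refine ⟨h, ?_, rfl⟩
  ext v
  simp [gradient]

theorem HasLap.gradient_eq {n : ℕ} {u : E n → ℝ} {x g : E n} {L : ℝ} (h : HasLap n u x g L) : gradient u x = g := by
  unfold gradient
  rw [h.grad]
  exact (InnerProductSpace.toDual ℝ (E n)).symm_apply_apply g

theorem lap_congr {n : ℕ} {u v : E n → ℝ} {x : E n} (h : u =ᶠ[nhds x] v) : lap n u x = lap n v x := by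
  unfold lap
  refine Finset.sum_congr rfl fun i _ => ?_
  have : (fun y => fderiv ℝ u y (EuclideanSpace.single i 1)) =ᶠ[nhds x] (fun y => fderiv ℝ v y (EuclideanSpace.single i 1)) := by
    filter_upwards [h.fderiv (𝕜 := ℝ)] with y hy
    rw [hy]
  rw [this.fderiv_eq]

theorem HasLap.congr {n : ℕ} {u v : E n → ℝ} {x g : E n} {L : ℝ} (h : HasLap n u x g L) (huv : v =ᶠ[nhds x] u) : HasLap n v x g L :=
  ⟨h.smooth.congr_of_eventuallyEq huv, huv.fderiv_eq.trans h.grad, (lap_congr huv).trans h.lapl⟩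

theorem HasLap.cast {n : ℕ} {u : E n → ℝ} {x g g' : E n} {L L' : ℝ} (h : HasLap n u x g L) (hg : g = g') (hL : L = L') : HasLap n u x g' L' := by
  subst hg hL; exact h

theorem HasLap.const (n : ℕ) (c : ℝ) (x : E n) : HasLap n (fun _ => c) x 0 0 := by
  refine ⟨contDiffAt_const, by simp, ?_⟩
  simp [lap]

theorem HasLap.add {n : ℕ} {u v : E n → ℝ} {x g g' : E n} {L L' : ℝ} (h : HasLap n u x g L) (h' : HasLap n v x g' L') :
    HasLap n (fun y => u y + v y) x (g + g') (L + L') := by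
  refine ⟨h.smooth.add h'.smooth, ?_, ?_⟩
  · rw [fderiv_fun_add (ev_diff h.smooth).self_of_nhds (ev_diff h'.smooth).self_of_nhds, h.grad, h'.grad, map_add]
  · rw [← h.lapl, ← h'.lapl]
    unfold lap
    rw [← Finset.sum_add_distrib]
    refine Finset.sum_congr rfl fun i _ => ?_
    have : (fun y => fderiv ℝ (fun y => u y + v y) y (EuclideanSpace.single i 1)) =ᶠ[nhds x]
        (fun y => fderiv ℝ u y (EuclideanSpace.single i 1) + fderiv ℝ v y (EuclideanSpace.single i 1)) := by
      filter_upwards [ev_diff h.smooth, ev_diff h'.smooth] with y h1 h2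
      rw [fderiv_fun_add h1 h2]; rfl
    rw [this.fderiv_eq, fderiv_fun_add (pd_diff h.smooth _) (pd_diff h'.smooth _)]
    rfl

theorem inner_sum_single {n : ℕ} (g g' : E n) : ∑ i, g i * g' i = inner ℝ g g' := by
  simp [PiLp.inner_apply, mul_comm]

theorem HasLap.mul {n : ℕ} {u v : E n → ℝ} {x g g' : E n} {L L' : ℝ} (h : HasLap n u x g L) (h' : HasLap n v x g' L') :
    HasLap n (fun y => u y * v y) x (u x • g' + v x • g) (u x * L' + v x * L + 2 * inner ℝ g g') := by
  refine ⟨h.smooth.mul h'.smooth, ?_, ?_⟩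
  · rw [fderiv_fun_mul (ev_diff h.smooth).self_of_nhds (ev_diff h'.smooth).self_of_nhds, h.grad, h'.grad, map_add, map_smul, map_smul]
  · rw [← h.lapl, ← h'.lapl, ← inner_sum_single]
    unfold lap
    rw [Finset.mul_sum, Finset.mul_sum, Finset.mul_sum, ← Finset.sum_add_distrib, ← Finset.sum_add_distrib]
    refine Finset.sum_congr rfl fun i _ => ?_
    have : (fun y => fderiv ℝ (fun y => u y * v y) y (EuclideanSpace.single i 1)) =ᶠ[nhds x]
        (fun y => u y * fderiv ℝ v y (EuclideanSpace.single i 1) + v y * fderiv ℝ u y (EuclideanSpace.single i 1)) := by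
      filter_upwards [ev_diff h.smooth, ev_diff h'.smooth] with y h1 h2
      rw [fderiv_fun_mul h1 h2]; rfl
    have d1 := (ev_diff h.smooth).self_of_nhds
    have d2 := (ev_diff h'.smooth).self_of_nhds
    have p1 := pd_diff h.smooth (EuclideanSpace.single i 1)
    have p2 := pd_diff h'.smooth (EuclideanSpace.single i 1)
    rw [this.fderiv_eq, fderiv_fun_add (d1.fun_mul p2) (d2.fun_mul p1), fderiv_fun_mul d1 p2, fderiv_fun_mul d2 p1]
    simp [h.grad, h'.grad, EuclideanSpace.inner_single_right]
    ring

theorem HasLap.comp {n : ℕ} {u : E n → ℝ} {x g : E n} {L : ℝ} (h : HasLap n u x g L) (φ φ' : ℝ → ℝ) (φ'' : ℝ)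
    (hc : ContDiffAt ℝ 2 φ (u x)) (h1 : ∀ᶠ t in nhds (u x), HasDerivAt φ (φ' t) t) (h2 : HasDerivAt φ' φ'' (u x)) :
    HasLap n (fun y => φ (u y)) x (φ' (u x) • g) (φ' (u x) * L + φ'' * ‖g‖^2) := by
  have hd := (ev_diff h.smooth).self_of_nhds
  refine ⟨hc.comp x h.smooth, ?_, ?_⟩
  · have := (h1.self_of_nhds.comp_hasFDerivAt x hd.hasFDerivAt).fderiv
    simp only [Function.comp_def] at this
    rw [this, h.grad, map_smul]
  · rw [← h.lapl, ← real_inner_self_eq_norm_sq, ← inner_sum_single]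
    unfold lap
    rw [Finset.mul_sum, Finset.mul_sum, ← Finset.sum_add_distrib]
    refine Finset.sum_congr rfl fun i _ => ?_
    have : (fun y => fderiv ℝ (fun y => φ (u y)) y (EuclideanSpace.single i 1)) =ᶠ[nhds x]
        (fun y => φ' (u y) * fderiv ℝ u y (EuclideanSpace.single i 1)) := by
      filter_upwards [ev_diff h.smooth, hd.continuousAt.eventually h1] with y h3 h4
      have := (h4.comp_hasFDerivAt y h3.hasFDerivAt).fderiv
      simp only [Function.comp_def] at this
      rw [this]; rfl
    have p1 := pd_diff h.smooth (EuclideanSpace.single i 1)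
    have hd2 := h2.comp_hasFDerivAt x hd.hasFDerivAt
    simp only [Function.comp_def] at hd2
    rw [this.fderiv_eq, (hd2.fun_mul p1.hasFDerivAt).fderiv]
    simp [h.grad, EuclideanSpace.inner_single_right]
    ring

theorem HasLap.lin (n : ℕ) (ξ x : E n) : HasLap n (fun y => inner ℝ ξ y) x ξ 0 := by
  have h1 : ∀ y, fderiv ℝ (fun y : E n => inner ℝ ξ y) y = innerSL ℝ ξ := fun y => (innerSL ℝ ξ).hasFDerivAt.fderiv
  refine ⟨(innerSL ℝ ξ).contDiff.contDiffAt, h1 x, ?_⟩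
  unfold lap
  simp [h1]

theorem HasLap.normSq (n : ℕ) (x : E n) : HasLap n (fun y => ‖y‖^2) x ((2:ℝ) • x) (2 * n) := by
  have h1 : ∀ y, fderiv ℝ (fun y : E n => ‖y‖^2) y = innerSL ℝ ((2:ℝ) • y) := fun y => by
    rw [(hasStrictFDerivAt_norm_sq y).hasFDerivAt.fderiv, map_smul]
    ext v; simp
  refine ⟨(contDiff_norm_sq ℝ).contDiffAt, h1 x, ?_⟩
  unfold lap
  simp only [h1]
  have : ∀ i : Fin n, fderiv ℝ (fun y : E n => innerSL ℝ ((2:ℝ) • y) (EuclideanSpace.single i 1)) x (EuclideanSpace.single i 1) = 2 := by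
    intro i
    have e1 : (fun y : E n => innerSL ℝ ((2:ℝ) • y) (EuclideanSpace.single i 1)) = fun y => inner ℝ ((2:ℝ) • EuclideanSpace.single i (1:ℝ)) y := by
      ext y
      simp [inner_smul_left, real_inner_comm]
    rw [e1, (HasLap.lin n _ x).grad]
    simp [inner_smul_left]
  rw [Finset.sum_congr rfl fun i _ => this i]
  simp [mul_comm]

theorem smooth_rpow (r : ℝ) (hr : 0 < r) (p : ℝ) : ∃ G : ℝ → ℝ, ContDiff ℝ (⊤ : ℕ∞) G ∧ ∀ t, r / 2 < t → G t = t ^ p := by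
  refine ⟨fun t => Real.smoothTransition (4 * t / r - 1) * t ^ p, ?_, ?_⟩
  · rw [contDiff_iff_contDiffAt]
    intro t
    by_cases ht : t = 0
    · subst ht
      have : (fun t => Real.smoothTransition (4 * t / r - 1) * t ^ p) =ᶠ[nhds 0] fun _ => 0 := by
        filter_upwards [gt_mem_nhds (show (0:ℝ) < r / 4 by positivity)] with t ht
        rw [Real.smoothTransition.zero_of_nonpos, zero_mul]
        rw [sub_nonpos, div_le_one hr]; linarith
      exact contDiffAt_const.congr_of_eventuallyEq this
    · refine ContDiffAt.mul ?_ (Real.contDiffAt_rpow_const_of_ne ht)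
      have : ContDiff ℝ (⊤ : ℕ∞) (fun t : ℝ => Real.smoothTransition (4 * t / r - 1)) :=
        Real.smoothTransition.contDiff.comp (by fun_prop)
      exact this.contDiffAt
  · intro t ht
    simp only
    rw [Real.smoothTransition.one_of_one_le, one_mul]
    rw [le_sub_iff_add_le, le_div_iff₀ hr]; linarith

theorem HasLap.distSq (n : ℕ) (P x : E n) : HasLap n (fun y => ‖y - P‖^2) x ((2:ℝ) • (x - P)) (2 * n) := by
  have := ((HasLap.normSq n x).add ((HasLap.lin n ((-2:ℝ) • P) x).add (HasLap.const n (‖P‖^2) x)))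
  refine (this.cast ?_ ?_).congr ?_
  · module
  · ring
  · refine Eventually.of_forall fun y => ?_
    simp only
    rw [norm_sub_sq_real, inner_smul_left, real_inner_comm P y]
    simp; ring

theorem sq_rpow (N : ℝ) (hN : 0 ≤ N) (j : ℕ) : (N^2) ^ (-(j:ℝ)/2) = (N^j)⁻¹ := by
  rw [← Real.rpow_natCast N 2, ← Real.rpow_mul hN, ← Real.rpow_natCast N j, ← Real.rpow_neg hN]
  congr 1; push_cast; ring

theorem base_pow (n : ℕ) (P : E n) (r : ℝ) (hr : 0 < r) (j : ℕ) : ∃ F : E n → ℝ, ContDiff ℝ (⊤ : ℕ∞) F ∧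
    ∀ x, r / 2 < ‖x - P‖^2 → F x = (‖x-P‖^j)⁻¹ ∧
      HasLap n F x ((-(j:ℝ) * (‖x-P‖^(j+2))⁻¹) • (x - P)) (j*(j+2-n)*(‖x-P‖^(j+2))⁻¹) := by
  obtain ⟨G, hG, hG2⟩ := smooth_rpow r hr (-(j:ℝ)/2)
  have hh : ContDiff ℝ (⊤ : ℕ∞) (fun y : E n => ‖y - P‖^2) := (contDiff_norm_sq ℝ).comp (contDiff_id.sub contDiff_const)
  refine ⟨fun x => G (‖x-P‖^2), hG.comp hh, fun x hx => ⟨?_, ?_⟩⟩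
  · simp only
    rw [hG2 _ hx, sq_rpow _ (norm_nonneg _)]
  · have hpos : 0 < ‖x-P‖^2 := by linarith
    have hN : 0 < ‖x-P‖ := by
      rcases (norm_nonneg (x-P)).eq_or_lt with h | h
      · rw [← h] at hpos; norm_num at hpos
      · exact h
    have key := (HasLap.distSq n P x).comp (fun t => t ^ (-(j:ℝ)/2)) (fun t => (-(j:ℝ)/2) * t ^ (-(j:ℝ)/2 - 1))
      ((-(j:ℝ)/2) * ((-(j:ℝ)/2 - 1) * (‖x-P‖^2) ^ (-(j:ℝ)/2 - 1 - 1))) (Real.contDiffAt_rpow_const_of_ne hpos.ne')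
      (by
        filter_upwards [lt_mem_nhds hpos] with t ht
        exact Real.hasDerivAt_rpow_const (Or.inl ht.ne'))
      ((Real.hasDerivAt_rpow_const (Or.inl hpos.ne')).const_mul _)
    have e1 : (-(j:ℝ)/2 - 1) = -((j+2:ℕ):ℝ)/2 := by push_cast; ring
    have e2 : (-((j+2:ℕ):ℝ)/2 - 1) = -((j+4:ℕ):ℝ)/2 := by push_cast; ring
    rw [e1, e2, sq_rpow _ hN.le, sq_rpow _ hN.le] at key
    refine (key.cast ?_ ?_).congr ?_
    · rw [smul_smul]; congr 1; ring
    · rw [norm_smul, mul_pow, show ((j+4:ℕ)) = j + 2 + 2 by ring, pow_add _ (j+2)]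
      push_cast
      field_simp
      norm_num
      ring
    · have : ∀ᶠ y in nhds x, r / 2 < ‖y - P‖^2 := hh.continuous.continuousAt.eventually (lt_mem_nhds hx)
      filter_upwards [this] with y hy
      exact hG2 _ hy

theorem lap_cont (n : ℕ) (u : E n → ℝ) (hu : ContDiff ℝ (⊤ : ℕ∞) u) : Continuous (lap n u) := by
  unfold lap
  refine continuous_finset_sum _ fun i _ => ?_
  have h1 : ContDiff ℝ 1 (fun y => fderiv ℝ u y (EuclideanSpace.single i 1)) := by
    have : ContDiff ℝ 1 (fderiv ℝ u) := hu.fderiv_right (by norm_cast)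
    exact this.clm_apply contDiff_const
  exact (h1.continuous_fderiv (by norm_num)).clm_apply continuous_const

theorem grad_cont (n : ℕ) (u : E n → ℝ) (hu : ContDiff ℝ (⊤ : ℕ∞) u) : Continuous (gradient u) := by
  unfold gradient
  exact (InnerProductSpace.toDual ℝ (E n)).symm.continuous.comp (hu.continuous_fderiv (by norm_num))

theorem smooth2 {n : ℕ} {u : E n → ℝ} (hu : ContDiff ℝ (⊤ : ℕ∞) u) (x : E n) : ContDiffAt ℝ 2 u x :=
  (hu.of_le (by norm_cast)).contDiffAt

def vgrad (k : ℕ) (ξ : E (k+5)) (δ : ℝ) (x : E (k+5)) : E (k+5) :=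
  (-((k:ℝ)+1) * (‖x-(1+δ)•ξ‖^(k+3))⁻¹) • (x - (1+δ)•ξ) +
    (((k:ℝ)+1)/4 * (δ*(2+δ))) • ((1-‖x‖^2) • ((-((k:ℝ)+3) * (‖x-(1+δ)•ξ‖^(k+5))⁻¹) • (x - (1+δ)•ξ)) + (‖x-(1+δ)•ξ‖^(k+3))⁻¹ • ((-2:ℝ) • x))

theorem vlem (k : ℕ) (ξ : E (k+5)) (hξ : ‖ξ‖ = 1) (δ : ℝ) (hδ : 0 < δ) : ∃ v : E (k+5) → ℝ, ContDiff ℝ (⊤ : ℕ∞) v ∧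
    ∀ x, δ^2 / 2 < ‖x - (1+δ)•ξ‖^2 →
      v x = (‖x-(1+δ)•ξ‖^(k+1))⁻¹ + ((k:ℝ)+1)/4 * (δ*(2+δ)) * ((1 - ‖x‖^2) * (‖x-(1+δ)•ξ‖^(k+3))⁻¹) ∧
      HasLap (k+5) v x (vgrad k ξ δ x)
        (-((k:ℝ)+1) * ((2 - ((k:ℝ)+1)*(δ*(2+δ))/2) * (‖x-(1+δ)•ξ‖^(k+3))⁻¹ +
          ((k:ℝ)+3)*(δ*(2+δ))*(1+δ)*inner ℝ ξ ((1+δ)•ξ - x) * (‖x-(1+δ)•ξ‖^(k+5))⁻¹)) := by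
  obtain ⟨F, hF, hF2⟩ := base_pow (k+5) ((1+δ)•ξ) (δ^2) (by positivity) (k+1)
  obtain ⟨G, hG, hG2⟩ := base_pow (k+5) ((1+δ)•ξ) (δ^2) (by positivity) (k+3)
  refine ⟨fun x => F x + ((k:ℝ)+1)/4 * (δ*(2+δ)) * ((1 + (-1) * ‖x‖^2) * G x), ?_, ?_⟩
  · exact hF.add (contDiff_const.mul ((contDiff_const.add (contDiff_const.mul (contDiff_norm_sq ℝ))).mul hG))
  · intro x hx
    obtain ⟨f1, f2⟩ := hF2 x hx
    obtain ⟨g1, g2⟩ := hG2 x hx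
    refine ⟨by simp only [f1, g1]; ring, ?_⟩
    have h1 := f2.add ((HasLap.const (k+5) (((k:ℝ)+1)/4 * (δ*(2+δ))) x).mul
      (((HasLap.const (k+5) 1 x).add ((HasLap.const (k+5) (-1) x).mul (HasLap.normSq (k+5) x))).mul g2))
    have hN : 0 < ‖x-(1+δ)•ξ‖ := by
      rcases (norm_nonneg (x-(1+δ)•ξ)).eq_or_lt with h | h
      · rw [← h] at hx; nlinarith
      · exact h
    refine h1.cast ?_ ?_
    · simp only [g1, vgrad]
      push_cast
      module
    · have e1 : inner ℝ x (x - (1+δ)•ξ) = ‖x - (1+δ)•ξ‖^2 - (1+δ) * inner ℝ ξ ((1+δ)•ξ - x) := by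
        have : x = (x - (1+δ)•ξ) + (1+δ)•ξ := by abel
        nth_rw 1 [this]
        rw [inner_add_left, real_inner_self_eq_norm_sq, inner_smul_left, ← neg_sub ((1+δ)•ξ) x, inner_neg_right]
        simp; ring
      simp only [g1, inner_zero_left, inner_add_left, inner_smul_left, inner_smul_right, smul_zero, zero_add, add_zero, mul_zero]
      rw [e1]
      generalize inner ℝ ξ ((1+δ)•ξ - x) = X
      generalize ‖x - (1+δ)•ξ‖ = N at *
      generalize ‖x‖ = R at *
      have e2 : N^(k+5) = N^(k+3) * N^2 := by ring
      have e3 : N^(k+3+2) = N^(k+3) * N^2 := by ring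
      have e4 : N^(k+1+2) = N^(k+3) := by ring
      rw [e3, e4]
      push_cast
      have : N^(k+3) ≠ 0 := by positivity
      simp
      field_simp
      ring

def tau (n : ℕ) (ξ x : E n) : ℝ := inner ℝ ξ x * (3 - ‖x‖^2) / 2

theorem tau_smooth (n : ℕ) (ξ : E n) : ContDiff ℝ (⊤ : ℕ∞) (tau n ξ) := by
  unfold tau
  exact (((innerSL ℝ ξ).contDiff).mul (contDiff_const.sub (contDiff_norm_sq ℝ))).div_const _

theorem tau_sphere (n : ℕ) (ξ x : E n) (hx : ‖x‖ = 1) : tau n ξ x = inner ℝ ξ x := by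
  rw [tau, hx]; ring

theorem tau_rad (n : ℕ) (ξ x : E n) (hx : ‖x‖ = 1) : fderiv ℝ (tau n ξ) x x = 0 := by
  have h1 := (HasLap.lin n ξ x).mul ((HasLap.const n (3/2) x).add ((HasLap.const n (-1/2) x).mul (HasLap.normSq n x)))
  have h2 : HasLap n (tau n ξ) x _ _ := h1.congr (Eventually.of_forall fun y => by simp only [tau]; ring)
  rw [h2.grad]
  simp only [innerSL_apply_apply, inner_add_left, inner_smul_left, smul_zero, add_zero, zero_add, real_inner_self_eq_norm_sq, hx]
  simp; ring

theorem inner_le (n : ℕ) (ξ x : E n) (hξ : ‖ξ‖ = 1) (hx : ‖x‖ ≤ 1) : |inner ℝ ξ x| ≤ 1 :=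
  (abs_real_inner_le_norm ξ x).trans (by rw [hξ, one_mul]; exact hx)

theorem tau_dist (n : ℕ) (ξ x : E n) (hξ : ‖ξ‖ = 1) (hx : ‖x‖ ≤ 1) : ‖x - ξ‖^2 ≤ 2 * (1 - tau n ξ x) := by
  have h1 := (abs_le.1 (inner_le n ξ x hξ hx)).2
  rw [norm_sub_sq_real, hξ, real_inner_comm, tau]
  have h2 : ‖x‖^2 ≤ 1 := by nlinarith [norm_nonneg x]
  nlinarith [mul_nonneg (sub_nonneg.2 h1) (sub_nonneg.2 h2)]

theorem tau_dist2 (n : ℕ) (ξ x : E n) (hξ : ‖ξ‖ = 1) (hx : ‖x‖ ≤ 1) : 1 - tau n ξ x ≤ 2 * ‖x - ξ‖ := by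
  have h0 := abs_le.1 (inner_le n ξ x hξ hx)
  have h1 : 1 - inner ℝ ξ x ≤ ‖x - ξ‖ := by
    have : 1 - inner ℝ ξ x = inner ℝ ξ (ξ - x) := by rw [inner_sub_right, real_inner_self_eq_norm_sq, hξ]; ring
    rw [this, norm_sub_rev]
    exact (real_inner_le_norm _ _).trans (by rw [hξ, one_mul])
  have h2 : 1 - ‖x‖ ≤ ‖x - ξ‖ := by
    have := norm_sub_norm_le ξ x
    rw [hξ, norm_sub_rev] at this; exact this
  have h3 := norm_nonneg x
  rw [tau]
  have h4 : (1 - ‖x‖^2) ≤ 2 * ‖x - ξ‖ := by nlinarith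
  have h5 : 0 ≤ 1 - ‖x‖^2 := by nlinarith
  nlinarith [mul_nonneg (sub_nonneg.2 h0.1) h5]

theorem distP1 (n : ℕ) (ξ x : E n) (hξ : ‖ξ‖ = 1) (hx : ‖x‖ ≤ 1) (δ : ℝ) (hδ : 0 < δ) : δ ≤ ‖x - (1+δ)•ξ‖ := by
  have := norm_sub_norm_le ((1+δ)•ξ) x
  rw [norm_smul, hξ, norm_sub_rev, Real.norm_eq_abs, abs_of_pos (by linarith)] at this
  linarith

theorem distP2 (n : ℕ) (ξ x : E n) (hξ : ‖ξ‖ = 1) (hx : ‖x‖ ≤ 1) (δ : ℝ) (hδ : 0 < δ) : ‖x - ξ‖ ≤ ‖x - (1+δ)•ξ‖ := by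
  have h0 := (abs_le.1 (inner_le n ξ x hξ hx)).2
  rw [← sq_le_sq₀ (norm_nonneg _) (norm_nonneg _), norm_sub_sq_real, norm_sub_sq_real, inner_smul_right, norm_smul, hξ,
    Real.norm_eq_abs, abs_of_pos (by linarith), real_inner_comm]
  nlinarith [mul_nonneg hδ.le (sub_nonneg.2 h0)]

theorem distP3 (n : ℕ) (ξ x : E n) (hξ : ‖ξ‖ = 1) (hx : ‖x‖ ≤ 1) (δ : ℝ) (hδ : 0 < δ) (hδ1 : δ ≤ 1) : ‖x - (1+δ)•ξ‖ ≤ 3 := by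
  refine (norm_sub_le _ _).trans ?_
  rw [norm_smul, hξ, Real.norm_eq_abs, abs_of_pos (by linarith)]
  linarith

theorem distP4 (n : ℕ) (ξ x : E n) (hξ : ‖ξ‖ = 1) (hx : ‖x‖ < 1) (δ : ℝ) : δ < inner ℝ ξ ((1+δ)•ξ - x) := by
  have h1 : inner ℝ ξ x < 1 := (real_inner_le_norm ξ x).trans_lt (by rw [hξ, one_mul]; exact hx)
  rw [inner_sub_right, inner_smul_right, real_inner_self_eq_norm_sq, hξ]
  linarith

theorem exists_chi (κ : ℝ) (hκ : 0 < κ) : ∃ χ : ℝ → ℝ, ContDiff ℝ (⊤ : ℕ∞) χ ∧ (∀ t, 0 ≤ χ t) ∧ (∀ t, χ t ≤ 1) ∧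
    (∀ t, t ≤ 1 - κ → χ t = 0) ∧ (∀ t, 1 - κ/2 ≤ t → χ t = 1) := by
  refine ⟨fun t => Real.smoothTransition ((t - (1-κ)) * (2/κ)), Real.smoothTransition.contDiff.comp (by fun_prop), fun t => Real.smoothTransition.nonneg _,
    fun t => Real.smoothTransition.le_one _, fun t ht => ?_, fun t ht => ?_⟩
  · exact Real.smoothTransition.zero_of_nonpos (mul_nonpos_of_nonpos_of_nonneg (by linarith) (by positivity))
  · refine Real.smoothTransition.one_of_one_le ?_
    rw [← div_le_iff₀ (by positivity)]
    rw [one_div_div]; linarith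

theorem vgrad_sphere (k : ℕ) (ξ : E (k+5)) (hξ : ‖ξ‖ = 1) (δ : ℝ) (hδ : 0 < δ) (hδ1 : δ ≤ 1) (x : E (k+5)) (hx : ‖x‖ = 1) :
    ‖vgrad k ξ δ x‖ ≤ 3 * ((k:ℝ)+1) * (‖x-(1+δ)•ξ‖^(k+2))⁻¹ := by
  have hN := distP1 _ ξ x hξ hx.le δ hδ
  rw [vgrad, hx]
  set N := ‖x-(1+δ)•ξ‖ with hNd
  have hN0 : 0 < N := by linarith
  refine (norm_add_le _ _).trans ?_
  have h1 : ‖(-((k:ℝ)+1) * (N^(k+3))⁻¹) • (x - (1+δ)•ξ)‖ = ((k:ℝ)+1) * (N^(k+2))⁻¹ := by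
    rw [norm_smul, ← hNd, norm_mul, norm_neg, Real.norm_of_nonneg (by positivity), Real.norm_of_nonneg (by positivity)]
    rw [pow_succ N (k+2)]
    field_simp
  have h2 : ‖(((k:ℝ)+1)/4 * (δ*(2+δ))) • (((1:ℝ)-1^2) • ((-((k:ℝ)+3) * (N^(k+5))⁻¹) • (x - (1+δ)•ξ)) + (N^(k+3))⁻¹ • ((-2:ℝ) • x))‖
      = ((k:ℝ)+1)/2 * (δ*(2+δ)) * (N^(k+3))⁻¹ := by
    rw [show (1:ℝ)-1^2 = 0 by norm_num, zero_smul, zero_add, norm_smul, norm_smul, norm_smul, hx, Real.norm_of_nonneg (by positivity), Real.norm_of_nonneg (by positivity)]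
    norm_num
    ring
  rw [h1, h2]
  have h3 : δ*(2+δ) * (N^(k+3))⁻¹ ≤ 3 * (N^(k+2))⁻¹ := by
    rw [pow_succ N (k+2), mul_inv, mul_comm _ N⁻¹, ← mul_assoc]
    gcongr
    rw [← div_eq_mul_inv, div_le_iff₀ hN0]
    nlinarith
  have hp : 0 ≤ (N^(k+2))⁻¹ := by positivity
  nlinarith [mul_le_mul_of_nonneg_left h3 (show (0:ℝ) ≤ ((k:ℝ)+1)/2 by positivity), mul_nonneg (show (0:ℝ) ≤ (k:ℝ)+1 by positivity) hp]

theorem cbd (k : ℕ) (δ : ℝ) (hδ : 0 < δ) (hδ1 : δ ≤ 1) : ((k:ℝ)+1)/4 * (δ*(2+δ)) ≤ (k:ℝ)+1 := by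
  have h1 : δ*(2+δ) ≤ 4 := by nlinarith
  have h2 : (0:ℝ) ≤ k + 1 := by positivity
  nlinarith [mul_le_mul_of_nonneg_left h1 h2]

theorem vgrad_far (k : ℕ) (ξ : E (k+5)) (hξ : ‖ξ‖ = 1) (δ : ℝ) (hδ : 0 < δ) (hδ1 : δ ≤ 1) (x : E (k+5)) (hx : ‖x‖ ≤ 1)
    (ρ : ℝ) (hρ : 0 < ρ) (hx2 : ρ ≤ ‖x-(1+δ)•ξ‖) :
    ‖vgrad k ξ δ x‖ ≤ 3 * ((k:ℝ)+1) * (ρ^(k+3))⁻¹ + ((k:ℝ)+1) * (3*((k:ℝ)+3) * (ρ^(k+5))⁻¹ + 2*(ρ^(k+3))⁻¹) := by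
  have hN3 := distP3 _ ξ x hξ hx δ hδ hδ1
  rw [vgrad]
  set N := ‖x-(1+δ)•ξ‖ with hNd
  have hN0 : 0 < N := by linarith
  have hs1 : 0 ≤ 1 - ‖x‖^2 := by nlinarith [norm_nonneg x]
  have hs2 : 1 - ‖x‖^2 ≤ 1 := by nlinarith [norm_nonneg x]
  refine (norm_add_le _ _).trans ?_
  have e1 : (N^(k+3))⁻¹ ≤ (ρ^(k+3))⁻¹ := by gcongr
  have e2 : (N^(k+5))⁻¹ ≤ (ρ^(k+5))⁻¹ := by gcongr
  refine add_le_add ?_ ?_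
  · rw [norm_smul, ← hNd, norm_mul, norm_neg, Real.norm_of_nonneg (by positivity), Real.norm_of_nonneg (by positivity)]
    calc _ ≤ ((k:ℝ)+1) * (ρ^(k+3))⁻¹ * 3 := by gcongr
      _ = _ := by ring
  · rw [norm_smul, norm_mul, Real.norm_of_nonneg (by positivity), Real.norm_of_nonneg (by positivity)]
    refine mul_le_mul (cbd k δ hδ hδ1) ?_ (norm_nonneg _) (by positivity)
    refine (norm_add_le _ _).trans (add_le_add ?_ ?_)
    · rw [norm_smul, norm_smul, ← hNd, norm_mul, norm_neg, Real.norm_of_nonneg hs1, Real.norm_of_nonneg (by positivity), Real.norm_of_nonneg (by positivity)]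
      calc _ ≤ 1 * (((k:ℝ)+3) * (ρ^(k+5))⁻¹ * 3) := by gcongr
        _ = _ := by ring
    · rw [norm_smul, norm_smul, Real.norm_of_nonneg (by positivity)]
      norm_num
      calc _ ≤ (ρ^(k+3))⁻¹ * (2 * 1) := by gcongr
        _ = _ := by ring

theorem v_far (k : ℕ) (x : E (k+5)) (hx : ‖x‖ ≤ 1) (N δ : ℝ)  (hδ : 0 < δ) (hδ1 : δ ≤ 1) 
    (ρ : ℝ) (hρ : 0 < ρ) (hx2 : ρ ≤ N) :
    |(N^(k+1))⁻¹ + ((k:ℝ)+1)/4 * (δ*(2+δ)) * ((1 - ‖x‖^2) * (N^(k+3))⁻¹)| ≤ (ρ^(k+1))⁻¹ + ((k:ℝ)+1)*(ρ^(k+3))⁻¹ := by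
  have hN0 : 0 < N := by linarith
  have hs1 : 0 ≤ 1 - ‖x‖^2 := by nlinarith [norm_nonneg x]
  have hs2 : 1 - ‖x‖^2 ≤ 1 := by nlinarith [norm_nonneg x]
  have e1 : (N^(k+3))⁻¹ ≤ (ρ^(k+3))⁻¹ := by gcongr
  rw [abs_of_nonneg (by positivity)]
  refine add_le_add (by gcongr) ?_
  refine mul_le_mul (cbd k δ hδ hδ1) ?_ (by positivity) (by positivity)
  calc _ ≤ 1 * (ρ^(k+3))⁻¹ := by gcongr
    _ = _ := one_mul _

def MM (k : ℕ) (ξ : E (k+5)) (δ : ℝ) (x : E (k+5)) : ℝ :=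
  ((k:ℝ)+1)*((1+δ)*(2+δ)) * ((‖x-(1+δ)•ξ‖^(k+3))⁻¹ + ((k:ℝ)+3)*δ*inner ℝ ξ ((1+δ)•ξ - x)*(‖x-(1+δ)•ξ‖^(k+5))⁻¹)

theorem vlap_bd (k : ℕ) (ξ x : E (k+5)) (hξ : ‖ξ‖ = 1) (hx : ‖x‖ < 1) (δ : ℝ) (hδ : 0 < δ) (hk : ((k:ℝ)+1)*(δ*(2+δ)) ≤ 8) :
   |(-((k:ℝ)+1) * ((2 - ((k:ℝ)+1)*(δ*(2+δ))/2) * (‖x-(1+δ)•ξ‖^(k+3))⁻¹ +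
          ((k:ℝ)+3)*(δ*(2+δ))*(1+δ)*inner ℝ ξ ((1+δ)•ξ - x) * (‖x-(1+δ)•ξ‖^(k+5))⁻¹))| ≤ MM k ξ δ x := by
  have hh := distP4 _ ξ x hξ hx δ
  rw [MM]
  generalize inner ℝ ξ ((1+δ)•ξ - x) = X at *
  have hX : 0 < X := by linarith
  have h1 : 0 ≤ (‖x-(1+δ)•ξ‖^(k+3))⁻¹ := by positivity
  have h2 : 0 ≤ (‖x-(1+δ)•ξ‖^(k+5))⁻¹ := by positivity
  generalize (‖x-(1+δ)•ξ‖^(k+3))⁻¹ = A at *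
  generalize (‖x-(1+δ)•ξ‖^(k+5))⁻¹ = B at *
  rw [abs_mul, abs_neg, abs_of_nonneg (by positivity : (0:ℝ) ≤ (k:ℝ)+1), mul_assoc ((k:ℝ)+1) ((1+δ)*(2+δ))]
  refine mul_le_mul_of_nonneg_left ?_ (by positivity)
  refine (abs_add_le _ _).trans ?_
  rw [abs_mul, abs_of_nonneg h1, abs_of_nonneg (by positivity : 0 ≤ ((k:ℝ)+3)*(δ*(2+δ))*(1+δ)*X*B), mul_add ((1+δ)*(2+δ))]
  refine add_le_add (?_ : _ ≤ (1+δ)*(2+δ)*A) (le_of_eq (by ring))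
  gcongr
  have : 0 ≤ ((k:ℝ)+1)*(δ*(2+δ)) := by positivity
  refine (abs_le.2 ⟨by linarith, by linarith⟩ : _ ≤ (2:ℝ)).trans (by nlinarith)

theorem bubble (k : ℕ) (ξ : E (k+5)) (hξ : ‖ξ‖ = 1) (κ : ℝ) (hκ : 0 < κ) (χ : ℝ → ℝ) (hχ : ContDiff ℝ (⊤ : ℕ∞) χ)
    (hχ0 : ∀ t, 0 ≤ χ t) (hχ1 : ∀ t, χ t ≤ 1) (hχ2 : ∀ t, t ≤ 1 - κ → χ t = 0) (hχ3 : ∀ t, 1 - κ/2 ≤ t → χ t = 1) :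
    ∃ K K2 : ℝ, 0 ≤ K ∧ 0 ≤ K2 ∧ ∀ δ : ℝ, 0 < δ → δ ≤ 1 → ((k:ℝ)+1)*(δ*(2+δ)) ≤ 8 → ∃ u : E (k+5) → ℝ, ContDiff ℝ (⊤ : ℕ∞) u ∧
      (∀ x, ‖x‖ = 1 → u x = √(δ*(2+δ))^(k+1) * (χ (inner ℝ ξ x) * (‖x-(1+δ)•ξ‖^(k+1))⁻¹)) ∧
      (∀ x, ‖x‖ = 1 → fderiv ℝ u x x = -(((k:ℝ)+1)/2) * u x) ∧
      (∀ x, tau (k+5) ξ x < 1 - κ → u =ᶠ[nhds x] fun _ => 0) ∧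
      (∀ x, ‖x‖ < 1 → |lap (k+5) u x| ≤ √(δ*(2+δ))^(k+1) * (MM k ξ δ x + K)) ∧
      (∀ x, ‖x‖ = 1 → ‖gradient u x‖^2 + (u x)^2 ≤ K2 * ((δ*(2+δ))^(k+1) * (‖x-(1+δ)•ξ‖^(2*(k+2)))⁻¹)) := by
  set η : E (k+5) → ℝ := fun x => χ (tau (k+5) ξ x) with hη
  have hηs : ContDiff ℝ (⊤ : ℕ∞) η := hχ.comp (tau_smooth _ _)
  obtain ⟨K1, hK1⟩ := (isCompact_closedBall (0 : E (k+5)) 1).exists_bound_of_continuousOn (lap_cont _ η hηs).continuousOn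
  obtain ⟨K0, hK0⟩ := (isCompact_closedBall (0 : E (k+5)) 1).exists_bound_of_continuousOn (grad_cont _ η hηs).continuousOn
  have hK1p : 0 ≤ K1 := (norm_nonneg _).trans (hK1 0 (by simp))
  have hK0p : 0 ≤ K0 := (norm_nonneg _).trans (hK0 0 (by simp))
  set ρ := κ/4 with hρ
  have hρ0 : 0 < ρ := by positivity
  refine ⟨((ρ^(k+1))⁻¹ + ((k:ℝ)+1)*(ρ^(k+3))⁻¹) * K1 + 2 * (K0 * (3 * ((k:ℝ)+1) * (ρ^(k+3))⁻¹ + ((k:ℝ)+1) * (3*((k:ℝ)+3) * (ρ^(k+5))⁻¹ + 2*(ρ^(k+3))⁻¹))),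
    (3 * ((k:ℝ)+1) + 3 * K0)^2 + 9, by positivity, by positivity, ?_⟩
  intro δ hδ hδ1 hδk
  obtain ⟨v, hv, hv2⟩ := vlem k ξ hξ δ hδ
  set Cs := √(δ*(2+δ))^(k+1) with hCs
  have hCs0 : 0 ≤ Cs := by positivity
  have hCs2 : Cs^2 = (δ*(2+δ))^(k+1) := by
    rw [hCs, ← pow_mul, mul_comm (k+1) 2, pow_mul, Real.sq_sqrt (by positivity)]
  have hfar : ∀ x : E (k+5), ‖x‖ ≤ 1 → δ^2/2 < ‖x-(1+δ)•ξ‖^2 := by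
    intro x hx
    have := distP1 _ ξ x hξ hx δ hδ
    nlinarith
  have hL : ∀ x : E (k+5), ‖x‖ ≤ 1 → HasLap (k+5) (fun y => Cs * (η y * v y)) x _ _ := fun x hx =>
    (HasLap.const (k+5) Cs x).mul ((HasLap.of_smooth (smooth2 hηs x)).mul (hv2 x (hfar x hx)).2)
  have hη1 : ∀ x, |η x| ≤ 1 := fun x => abs_le.2 ⟨by linarith [hχ0 (tau (k+5) ξ x)], hχ1 _⟩
  have hrad : ∀ x, ‖x‖ = 1 → inner ℝ (gradient η x) x = 0 := by
    intro x hx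
    have h1 : fderiv ℝ η x x = inner ℝ (gradient η x) x := by
      rw [(HasLap.of_smooth (smooth2 hηs x)).grad]; rfl
    rw [← h1]
    have h2 : fderiv ℝ η x = (fderiv ℝ χ (tau (k+5) ξ x)).comp (fderiv ℝ (tau (k+5) ξ) x) :=
      fderiv_comp x (hχ.differentiable (by simp) _) ((tau_smooth _ _).differentiable (by simp) _)
    rw [h2, ContinuousLinearMap.comp_apply, tau_rad _ _ _ hx, map_zero]
  have hvs : ∀ x, ‖x‖ = 1 → v x = (‖x-(1+δ)•ξ‖^(k+1))⁻¹ := by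
    intro x hx
    rw [(hv2 x (hfar x hx.le)).1, hx]; ring
  refine ⟨fun y => Cs * (η y * v y), contDiff_const.mul (hηs.mul hv), ?_, ?_, ?_, ?_, ?_⟩
  · intro x hx
    simp only
    rw [hvs x hx, hη]; simp only [tau_sphere _ _ _ hx]
  · intro x hx
    rw [(hL x hx.le).grad]
    simp only [innerSL_apply_apply, inner_add_left, inner_smul_left, smul_zero, add_zero, hrad x hx]
    have hN0 : 0 < ‖x-(1+δ)•ξ‖ := by linarith [distP1 _ ξ x hξ hx.le δ hδ]
    have e1 : inner ℝ (vgrad k ξ δ x) x = -(((k:ℝ)+1)/2) * v x := by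
      rw [hvs x hx, vgrad, hx]
      simp only [inner_add_left, inner_smul_left, inner_sub_left, real_inner_self_eq_norm_sq, hx]
      have e2 : ‖x-(1+δ)•ξ‖^2 = 1 - 2 * ((1+δ) * inner ℝ ξ x) + (1+δ)^2 := by
        rw [norm_sub_sq_real, inner_smul_right, norm_smul, hξ, hx, Real.norm_eq_abs, abs_of_pos (by linarith), real_inner_comm]
        ring
      have e3 : (‖x-(1+δ)•ξ‖^(k+1))⁻¹ = ‖x-(1+δ)•ξ‖^2 * (‖x-(1+δ)•ξ‖^(k+3))⁻¹ := by
        rw [show k+3 = k+1+2 by ring, pow_add _ (k+1)]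
        field_simp
      rw [e3, e2]
      simp
      ring
    rw [e1]
    simp
    ring
  · intro x hx
    have : ∀ᶠ y in nhds x, tau (k+5) ξ y < 1 - κ := (tau_smooth (k+5) ξ).continuous.continuousAt.eventually (gt_mem_nhds hx)
    filter_upwards [this] with y hy
    simp only [hη]
    rw [hχ2 _ hy.le]; ring
  · intro x hx
    rw [(hL x hx.le).lapl]
    simp only [mul_zero, add_zero, inner_zero_left]
    rw [abs_mul, abs_of_nonneg hCs0]
    gcongr
    rw [add_assoc]
    refine (abs_add_le _ _).trans (add_le_add ?_ ?_)
    · rw [abs_mul]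
      refine (mul_le_of_le_one_left (abs_nonneg _) (hη1 x)).trans (vlap_bd k ξ x hξ hx δ hδ hδk)
    · rcases lt_or_ge (1 - κ/2) (tau (k+5) ξ x) with ht | ht
      · have : ∀ᶠ y in nhds x, 1 - κ/2 < tau (k+5) ξ y := (tau_smooth (k+5) ξ).continuous.continuousAt.eventually (lt_mem_nhds ht)
        have h1 : HasLap (k+5) η x 0 0 := (HasLap.const (k+5) 1 x).congr (this.mono fun y hy => hχ3 _ hy.le)
        rw [h1.lapl, h1.gradient_eq]
        simp only [mul_zero, add_zero, inner_zero_left, abs_zero]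
        positivity
      · have h1 := tau_dist2 _ ξ x hξ hx.le
        have h2 := distP2 _ ξ x hξ hx.le δ hδ
        have h3 : ρ ≤ ‖x-(1+δ)•ξ‖ := by rw [hρ]; linarith
        refine (abs_add_le _ _).trans (add_le_add ?_ ?_)
        · rw [abs_mul, (hv2 x (hfar x hx.le)).1]
          exact mul_le_mul (v_far k x hx.le _ δ hδ hδ1 ρ hρ0 h3) (hK1 x (by simpa using hx.le)) (abs_nonneg _) (by positivity)
        · rw [abs_mul, abs_two]
          gcongr
          exact (abs_real_inner_le_norm _ _).trans (mul_le_mul (hK0 x (by simpa using hx.le)) (vgrad_far k ξ hξ δ hδ hδ1 x hx.le ρ hρ0 h3) (norm_nonneg _) hK0p)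
  · intro x hx
    have hN0 : 0 < ‖x-(1+δ)•ξ‖ := by linarith [distP1 _ ξ x hξ hx.le δ hδ]
    have hN3 := distP3 _ ξ x hξ hx.le δ hδ hδ1
    rw [(hL x hx.le).gradient_eq]
    simp only [smul_zero, add_zero]
    have e0 : (‖x-(1+δ)•ξ‖^(k+1))⁻¹ ≤ 3 * (‖x-(1+δ)•ξ‖^(k+2))⁻¹ := by
      rw [pow_succ _ (k+1), mul_inv, mul_comm _ (‖x-(1+δ)•ξ‖)⁻¹, ← mul_assoc]
      refine le_mul_of_one_le_left (by positivity) ?_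
      rw [← div_eq_mul_inv, le_div_iff₀ hN0]; linarith
    have e1 : ‖η x • vgrad k ξ δ x + v x • gradient η x‖ ≤ (3 * ((k:ℝ)+1) + 3 * K0) * (‖x-(1+δ)•ξ‖^(k+2))⁻¹ := by
      refine (norm_add_le _ _).trans ?_
      rw [norm_smul, norm_smul, add_mul]
      refine add_le_add ((mul_le_of_le_one_left (norm_nonneg _) (hη1 x)).trans (vgrad_sphere k ξ hξ δ hδ hδ1 x hx)) ?_
      rw [hvs x hx, Real.norm_of_nonneg (by positivity)]
      calc _ ≤ 3 * (‖x-(1+δ)•ξ‖^(k+2))⁻¹ * K0 := by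
            gcongr
            exact hK0 x (by simpa using hx.le)
        _ = _ := by ring
    have e2 : |η x * v x| ≤ 3 * (‖x-(1+δ)•ξ‖^(k+2))⁻¹ := by
      rw [abs_mul]
      refine (mul_le_of_le_one_left (abs_nonneg _) (hη1 x)).trans ?_
      rw [hvs x hx, abs_of_nonneg (by positivity)]; exact e0
    have e3 : (‖x-(1+δ)•ξ‖^(2*(k+2)))⁻¹ = ((‖x-(1+δ)•ξ‖^(k+2))⁻¹)^2 := by
      rw [mul_comm, pow_mul, inv_pow]
    rw [norm_smul, mul_pow, mul_pow, e3, ← hCs2, Real.norm_of_nonneg hCs0, ← sq_abs (η x * v x)]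
    calc _ ≤ Cs^2 * ((3 * ((k:ℝ)+1) + 3 * K0) * (‖x-(1+δ)•ξ‖^(k+2))⁻¹)^2 + Cs^2 * (3 * (‖x-(1+δ)•ξ‖^(k+2))⁻¹)^2 := by gcongr
      _ = _ := by ring

def Abd (k : ℕ) (ε K δ : ℝ) : ℝ :=
  (1+ε) * ((((k:ℝ)+1)*((1+δ)*(2+δ)))^2 * (2+δ)^(k+1) * (((k:ℝ)+5)*(k+3)/(2*(k+1)) * mom (k+5) (k+3))) +
    (1+1/ε) * (K^2 * (δ*(2+δ))^(k+1) * (volume (ball (0 : E (k+5)) 1)).toReal)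

theorem MM_int (k : ℕ) (ξ : E (k+5)) (hξ : ‖ξ‖ = 1) (δ : ℝ) (hδ : 0 < δ) :
    ∫⁻ x in ball (0 : E (k+5)) 1, ENNReal.ofReal (MM k ξ δ x ^ 2) ≤
      ENNReal.ofReal ((((k:ℝ)+1)*((1+δ)*(2+δ)))^2 * ((δ^(k+1))⁻¹ * (((k:ℝ)+5)*(k+3)/(2*(k+1)) * mom (k+5) (k+3)))) := by
  have h := half_integral k ξ hξ δ hδ
  have hH : MeasurableSet {X : E (k+5) | δ < inner ℝ ξ X} := measurableSet_lt measurable_const (by fun_prop)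
  rw [ENNReal.ofReal_mul (by positivity), ← h]
  rw [← lintegral_const_mul _ (by fun_prop), ← lintegral_indicator hH, ← lintegral_indicator measurableSet_ball]
  refine le_trans ?_ (lintegral_sub_left_eq_self _ ((1+δ)•ξ)).le
  refine lintegral_mono fun x => ?_
  by_cases hx : x ∈ ball (0 : E (k+5)) 1
  swap
  · rw [Set.indicator_of_notMem hx]; exact zero_le
  rw [Set.indicator_of_mem hx]
  have hx1 : ‖x‖ < 1 := by simpa using hx
  rw [Set.indicator_of_mem (show (1+δ)•ξ - x ∈ {X : E (k+5) | δ < inner ℝ ξ X} from distP4 _ ξ x hξ hx1 δ)]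
  rw [← ENNReal.ofReal_mul (by positivity), MM, mul_pow, norm_sub_rev x]

theorem lap_int (k : ℕ) (ξ : E (k+5)) (hξ : ‖ξ‖ = 1) (δ : ℝ) (hδ : 0 < δ) (u : E (k+5) → ℝ) (hu : ContDiff ℝ (⊤ : ℕ∞) u) (K : ℝ)
    (hK : 0 ≤ K) (h : ∀ x, ‖x‖ < 1 → |lap (k+5) u x| ≤ √(δ*(2+δ))^(k+1) * (MM k ξ δ x + K)) (ε : ℝ) (hε : 0 < ε) :
    ∫ x in ball (0 : E (k+5)) 1, (lap (k+5) u x)^2 ≤ Abd k ε K δ := by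
  have hmom := mom_nonneg (k+5) (k+3)
  set c := ((k:ℝ)+5)*(k+3)/(2*(k+1)) * mom (k+5) (k+3) with hc
  have hc0 : 0 ≤ c := by positivity
  rw [integral_eq_lintegral_of_nonneg_ae (Eventually.of_forall fun x => sq_nonneg _)
    ((lap_cont _ u hu).pow 2).aestronglyMeasurable]
  refine ENNReal.toReal_le_of_le_ofReal (by unfold Abd; positivity) ?_
  set C := δ*(2+δ) with hC
  have hC0 : 0 < C := by positivity
  have hCs2 : (√C^(k+1))^2 = C^(k+1) := by
    rw [← pow_mul, mul_comm (k+1) 2, pow_mul, Real.sq_sqrt hC0.le]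
  have hpt : ∀ x ∈ ball (0 : E (k+5)) 1, ENNReal.ofReal ((lap (k+5) u x)^2) ≤
      ENNReal.ofReal ((1+ε)*C^(k+1)) * ENNReal.ofReal (MM k ξ δ x ^ 2) + ENNReal.ofReal ((1+1/ε)*(K^2*C^(k+1))) := by
    intro x hx
    rw [← ENNReal.ofReal_mul (by positivity), ← ENNReal.ofReal_add (by positivity) (by positivity)]
    refine ENNReal.ofReal_le_ofReal ?_
    rw [← sq_abs (lap (k+5) u x)]
    calc |lap (k+5) u x|^2 ≤ (√C^(k+1) * (MM k ξ δ x + K))^2 := by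
          gcongr; exact h x (by simpa using hx)
      _ = C^(k+1) * (MM k ξ δ x + K)^2 := by rw [mul_pow, hCs2]
      _ ≤ C^(k+1) * ((1+ε) * MM k ξ δ x^2 + (1+1/ε)*K^2) := by
          gcongr
          have : 0 ≤ (ε * MM k ξ δ x - K)^2 / ε := by positivity
          have e : (ε * MM k ξ δ x - K)^2 / ε = ε * MM k ξ δ x^2 - 2 * MM k ξ δ x * K + 1/ε*K^2 := by field_simp; ring
          nlinarith
      _ = _ := by ring
  refine (setLIntegral_mono' measurableSet_ball hpt).trans ?_
  have hvol : volume (ball (0 : E (k+5)) 1) ≠ ⊤ := measure_ball_lt_top.ne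
  rw [lintegral_add_right _ measurable_const, lintegral_const_mul' _ _ ENNReal.ofReal_ne_top]
  rw [lintegral_const, Measure.restrict_apply_univ]
  refine (add_le_add_left (mul_le_mul_right (MM_int k ξ hξ δ hδ) _) _).trans ?_
  rw [← ENNReal.ofReal_mul (by positivity)]
  nth_rw 1 [← ENNReal.ofReal_toReal hvol]
  rw [← ENNReal.ofReal_mul (by positivity), ← ENNReal.ofReal_add (by positivity) (by positivity)]
  refine ENNReal.ofReal_le_ofReal (le_of_eq ?_)
  rw [Abd, ← hc, ← hC]
  have : C^(k+1) = δ^(k+1) * (2+δ)^(k+1) := by rw [hC, mul_pow]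
  have hd : δ^(k+1) * (δ^(k+1))⁻¹ = 1 := mul_inv_cancel₀ (by positivity)
  nth_rw 1 [this]
  linear_combination (1+ε) * (2+δ)^(k+1) * (((k:ℝ)+1)*((1+δ)*(2+δ)))^2 * c * hd

theorem Abd_tendsto (k : ℕ) (ε K : ℝ) : Tendsto (Abd k ε K) (nhdsWithin 0 (Set.Ioi 0))
    (nhds ((1+ε) * (((k:ℝ)+1)*(k+3)*(k+5)/4 * SA (k+5)))) := by
  have h1 : Continuous (Abd k ε K) := by unfold Abd; fun_prop
  have h2 := (h1.tendsto 0).mono_left (nhdsWithin_le_nhds (s := Set.Ioi 0))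
  convert h2 using 2
  rw [Abd, mom_SA (k+5) (by omega)]
  simp only [show k+5-2 = k+3 by omega, show k+5-1=k+4 by omega, add_zero, zero_mul, one_mul]
  rw [zero_pow (by omega)]
  rw [show k+4 = k+1+3 by ring, pow_add _ (k+1) 3]
  field_simp
  ring

theorem B_tendsto (k : ℕ) (ξ : E (k+5)) (hξ : ‖ξ‖ = 1) :
    Tendsto (fun δ : ℝ => ∫ x, (δ*(2+δ))^(k+1) * (‖x-(1+δ)•ξ‖^(2*(k+2)))⁻¹ ∂(sphMeasure (k+5))) (nhdsWithin 0 (Set.Ioi 0)) (nhds 0) := by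
  have hne : ∀ᵐ x ∂(sphMeasure (k+5)), x ≠ ξ := by
    rw [ae_iff]; simpa using sph_atom (k+5) (by omega) ξ
  suffices H : Tendsto (fun δ : ℝ => ∫ x, (δ*(2+δ))^(k+1) * (‖x-(1+δ)•ξ‖^(2*(k+2)))⁻¹ ∂(sphMeasure (k+5))) (nhdsWithin 0 (Set.Ioi 0)) (nhds (∫ x, (0:ℝ) ∂(sphMeasure (k+5)))) by
    simpa using H
  refine tendsto_integral_filter_of_dominated_convergence (fun x => 3^(k+1) * (‖x-ξ‖^(k+3))⁻¹) ?_ ?_ ?_ ?_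
  · refine Eventually.of_forall fun δ => ?_
    refine Measurable.aestronglyMeasurable ?_
    fun_prop
  · have : Set.Ioc (0:ℝ) 1 ∈ nhdsWithin (0:ℝ) (Set.Ioi 0) := Ioc_mem_nhdsGT one_pos
    filter_upwards [this] with δ hδ
    filter_upwards [sph_ae (k+5), hne] with x hx hx2
    have h1 := distP1 _ ξ x hξ hx.le δ hδ.1
    have h2 := distP2 _ ξ x hξ hx.le δ hδ.1
    have h3 : 0 < ‖x - ξ‖ := norm_pos_iff.2 (sub_ne_zero.2 hx2)
    have h4 := hδ.1
    have h5 := hδ.2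
    set N := ‖x-(1+δ)•ξ‖
    have hN : 0 < N := by linarith
    rw [Real.norm_of_nonneg (by positivity)]
    calc (δ*(2+δ))^(k+1) * (N^(2*(k+2)))⁻¹ ≤ (3*N)^(k+1) * (N^(2*(k+2)))⁻¹ := by
          have : δ*(2+δ) ≤ 3*N := by nlinarith
          gcongr
      _ = 3^(k+1) * (N^(k+3))⁻¹ := by
          rw [show 2*(k+2) = (k+1)+(k+3) by ring]; field_simp; ring
      _ ≤ _ := by gcongr
  · exact (sph_sing (k+5) (by omega) ξ hξ).const_mul _
  · filter_upwards [hne] with x hx2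
    have h3 : 0 < ‖x - ξ‖ := norm_pos_iff.2 (sub_ne_zero.2 hx2)
    have : ContinuousAt (fun δ : ℝ => (δ*(2+δ))^(k+1) * (‖x-(1+δ)•ξ‖^(2*(k+2)))⁻¹) 0 := by
      refine ContinuousAt.mul (by fun_prop) (ContinuousAt.inv₀ (by fun_prop) ?_)
      rw [add_zero, one_smul]; positivity
    have h4 := this.tendsto.mono_left (nhdsWithin_le_nhds (s := Set.Ioi 0))
    simpa using h4

def kf (k : ℕ) (χ : ℝ → ℝ) (δ t : ℝ) : ℝ :=
  χ t ^ (2*((k:ℝ)+4)/((k:ℝ)+1)) * (δ*(2+δ) / max (1 - 2*(1+δ)*t + (1+δ)^2) (δ^2))^(k+4)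

theorem kf_cont (k : ℕ) (χ : ℝ → ℝ) (hχ : Continuous χ) (δ : ℝ) (hδ : 0 < δ) : Continuous (kf k χ δ) := by
  unfold kf
  refine Continuous.mul ?_ ?_
  · exact hχ.rpow_const fun t => Or.inr (by positivity)
  · refine Continuous.pow (continuous_const.div (by fun_prop) fun t => ?_) _
    have : 0 < δ^2 := by positivity
    exact (this.trans_le (le_max_right _ _)).ne'

theorem nsq (n : ℕ) (ξ x : E n) (hξ : ‖ξ‖ = 1) (hx : ‖x‖ = 1) (δ : ℝ) (hδ : 0 < δ) :
    ‖x-(1+δ)•ξ‖^2 = 1 - 2 * (1+δ) * inner ℝ ξ x + (1+δ)^2 := by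
  rw [norm_sub_sq_real, inner_smul_right, norm_smul, hξ, hx, Real.norm_eq_abs, abs_of_pos (by linarith), real_inner_comm]
  ring

theorem kf_eq (k : ℕ) (χ : ℝ → ℝ) (ξ x : E (k+5)) (hξ : ‖ξ‖ = 1) (hx : ‖x‖ = 1) (δ : ℝ) (hδ : 0 < δ) :
    kf k χ δ (inner ℝ ξ x) = χ (inner ℝ ξ x) ^ (2*((k:ℝ)+4)/((k:ℝ)+1)) * (δ*(2+δ) / ‖x-(1+δ)•ξ‖^2)^(k+4) := by
  have h1 := distP1 _ ξ x hξ hx.le δ hδ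
  rw [kf, ← nsq _ ξ x hξ hx δ hδ, max_eq_left (by gcongr)]

theorem kf_u (k : ℕ) (χ : ℝ → ℝ) (hχ0 : ∀ t, 0 ≤ χ t) (ξ x : E (k+5)) (hξ : ‖ξ‖ = 1) (hx : ‖x‖ = 1) (δ : ℝ) (hδ : 0 < δ) :
    |√(δ*(2+δ))^(k+1) * (χ (inner ℝ ξ x) * (‖x-(1+δ)•ξ‖^(k+1))⁻¹)| ^ (2*((k:ℝ)+4)/((k:ℝ)+1)) = kf k χ δ (inner ℝ ξ x) := by
  have h1 := distP1 _ ξ x hξ hx.le δ hδ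
  rw [kf_eq k χ ξ x hξ hx δ hδ]
  have h0 := hχ0 (inner ℝ ξ x)
  set N := ‖x-(1+δ)•ξ‖
  have hN : 0 < N := by linarith
  set C := δ*(2+δ)
  have hC : 0 < C := by positivity
  have e : √C^(k+1) * (χ (inner ℝ ξ x) * (N^(k+1))⁻¹) = χ (inner ℝ ξ x) * (√C/N)^(k+1) := by
    rw [div_pow]; ring
  rw [e, abs_of_nonneg (by positivity), Real.mul_rpow h0 (by positivity)]
  congr 1
  have e2 : C / N^2 = (√C/N)^2 := by rw [div_pow, Real.sq_sqrt hC.le]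
  rw [e2, ← Real.rpow_natCast, ← Real.rpow_natCast, ← Real.rpow_natCast, ← Real.rpow_mul (by positivity), ← Real.rpow_mul (by positivity)]
  congr 1
  push_cast
  field_simp

theorem kf_low (k : ℕ) (ξ : E (k+5)) (hξ : ‖ξ‖ = 1) (κ : ℝ) (hκ : 0 < κ) (χ : ℝ → ℝ) (hχ : Continuous χ)
    (hχ0 : ∀ t, 0 ≤ χ t) (hχ3 : ∀ t, 1 - κ/2 ≤ t → χ t = 1) (δ : ℝ) (hδ : 0 < δ) :
    SA (k+5) * (1 - (δ*(2+δ)/(κ/4)^2)^(k+4)) ≤ ∫ x, kf k χ δ (inner ℝ ξ x) ∂(sphMeasure (k+5)) := by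
  have hc := conf_sphere (k+5) (by omega) ξ hξ δ hδ
  set g : E (k+5) → ℝ := fun x => (δ*(2+δ)/ max (1 - 2*(1+δ)*inner ℝ ξ x + (1+δ)^2) (δ^2))^(k+4) with hg
  have hgc : Continuous g := by
    refine Continuous.pow (continuous_const.div (by fun_prop) fun t => ?_) _
    have : 0 < δ^2 := by positivity
    exact (this.trans_le (le_max_right _ _)).ne'
  have hmx : ∀ x, ‖x‖ = 1 → max (1 - 2*(1+δ)*inner ℝ ξ x + (1+δ)^2) (δ^2) = ‖x-(1+δ)•ξ‖^2 := by
    intro x hx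
    have h1 := distP1 _ ξ x hξ hx.le δ hδ
    rw [← nsq _ ξ x hξ hx δ hδ, max_eq_left (by gcongr)]
  have hgi : ∫ x, g x ∂(sphMeasure (k+5)) = SA (k+5) := by
    rw [integral_eq_lintegral_of_nonneg_ae (Eventually.of_forall fun x => by positivity) hgc.aestronglyMeasurable, SA, ← hc]
    congr 1
    refine lintegral_congr_ae ?_
    filter_upwards [sph_ae (k+5)] with x hx
    simp only [hg]
    rw [hmx x hx, nsq _ ξ x hξ hx δ hδ, hx]
    norm_num
  have hkc : Continuous (fun x : E (k+5) => kf k χ δ (inner ℝ ξ x)) := (kf_cont k χ hχ δ hδ).comp (by fun_prop)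
  have hmono : ∫ x, (g x - (δ*(2+δ)/(κ/4)^2)^(k+4)) ∂(sphMeasure (k+5)) ≤ ∫ x, kf k χ δ (inner ℝ ξ x) ∂(sphMeasure (k+5)) := by
    refine integral_mono_ae (sph_cont_int _ _ (hgc.sub continuous_const)) (sph_cont_int _ _ hkc) ?_
    filter_upwards [sph_ae (k+5)] with x hx
    have h1 := distP1 _ ξ x hξ hx.le δ hδ
    have h2 := distP2 _ ξ x hξ hx.le δ hδ
    rw [kf_eq k χ ξ x hξ hx δ hδ]
    simp only [hg]
    rw [hmx x hx]
    have hN : 0 < ‖x-(1+δ)•ξ‖ := by linarith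
    rcases lt_or_ge ‖x - ξ‖ (κ/4) with h | h
    · have h3 := tau_dist2 _ ξ x hξ hx.le
      rw [tau_sphere _ _ _ hx] at h3
      rw [hχ3 _ (by linarith), Real.one_rpow, one_mul]
      have : 0 ≤ (δ*(2+δ)/(κ/4)^2)^(k+4) := by positivity
      linarith
    · have h4 : (δ*(2+δ)/‖x-(1+δ)•ξ‖^2)^(k+4) ≤ (δ*(2+δ)/(κ/4)^2)^(k+4) := by
        gcongr; linarith
      have h5 : 0 ≤ χ (inner ℝ ξ x) ^ (2*((k:ℝ)+4)/((k:ℝ)+1)) * (δ*(2+δ) / ‖x-(1+δ)•ξ‖^2)^(k+4) :=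
        mul_nonneg (Real.rpow_nonneg (hχ0 _) _) (by positivity)
      linarith
  refine le_trans (le_of_eq ?_) hmono
  rw [integral_sub (sph_cont_int _ _ hgc) (integrable_const _), hgi, integral_const]
  simp only [smul_eq_mul, Measure.real]
  rw [← SA]; ring

theorem loc_single (n : ℕ) {ι : Type} [Fintype ι] [Nonempty ι] (z : ι → E n) (hz : ∀ i, ‖z i‖ = 1) (κ : ℝ)
    (hsep : ∀ i j, i ≠ j → 8 * κ < ‖z i - z j‖^2) (u : ι → E n → ℝ) (hu : ∀ i x, tau n (z i) x < 1 - κ → u i =ᶠ[nhds x] fun _ => 0)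
    (w : ι → ℝ) (x : E n) (hx : ‖x‖ ≤ 1) :
    ∃ i0, (∀ i, i ≠ i0 → u i =ᶠ[nhds x] fun _ => 0) ∧ (fun y => ∑ i, w i * u i y) =ᶠ[nhds x] fun y => w i0 * u i0 y := by
  classical
  have key : ∃ i0, ∀ i, i ≠ i0 → tau n (z i) x < 1 - κ := by
    by_cases h : ∃ i0, 1 - κ ≤ tau n (z i0) x
    · obtain ⟨i0, h0⟩ := h
      refine ⟨i0, fun i hi => ?_⟩
      by_contra hc
      push Not at hc
      have h1 := tau_dist n (z i) x (hz i) hx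
      have h2 := tau_dist n (z i0) x (hz i0) hx
      have h3 := hsep i i0 hi
      have h4 : ‖z i - z i0‖ ≤ ‖x - z i‖ + ‖x - z i0‖ := by
        have : z i - z i0 = (x - z i0) - (x - z i) := by abel
        rw [this, add_comm]; exact norm_sub_le _ _
      nlinarith [norm_nonneg (z i - z i0), norm_nonneg (x - z i), norm_nonneg (x - z i0), sq_nonneg (‖x - z i‖ - ‖x - z i0‖)]
    · push Not at h
      exact ⟨Classical.arbitrary ι, fun i _ => h i⟩
  obtain ⟨i0, h0⟩ := key
  refine ⟨i0, fun i hi => hu i x (h0 i hi), ?_⟩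
  have : ∀ᶠ y in nhds x, ∀ i, i ≠ i0 → u i y = 0 := by
    rw [eventually_all]
    intro i
    by_cases hi : i = i0
    · exact Eventually.of_forall fun y h => absurd hi h
    · filter_upwards [hu i x (h0 i hi)] with y hy _ using hy
  filter_upwards [this] with y hy
  exact Finset.sum_eq_single i0 (fun i _ hi => by rw [hy i hi, mul_zero]) (by simp)

theorem core (k m : ℕ) (a b c : ℝ) (hc : 0 ≤ c)
    (h : ∀ f : E (k+5) → ℝ, ContDiff ℝ (⊤ : ℕ∞) f →
      (∀ p ∈ P0 (k+5) m,
        ∫ x, MvPolynomial.eval (fun i => x i) p * |f x| ^ (2 * ((k:ℝ) + 4) / ((k:ℝ) + 1)) ∂(sphMeasure (k+5)) = 0) →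
      (∀ x : E (k+5), ‖x‖ = 1 → fderiv ℝ f x x = -(((k:ℝ) + 1) / 2) * f x) →
      (∫ x, |f x| ^ (2 * ((k:ℝ) + 4) / ((k:ℝ) + 1)) ∂(sphMeasure (k+5))) ^ (((k:ℝ) + 1) / ((k:ℝ) + 4)) ≤
        a * (∫ x in Metric.ball (0 : E (k+5)) 1, (lap (k+5) f x) ^ 2) +
          b * ∫ x, (tgradNormSq (k+5) f x + c * (f x) ^ 2) ∂(sphMeasure (k+5)))
    {ι : Type} [Fintype ι] (z : ι → E (k+5)) (W : ι → ℝ) (hg : FinGood (k+5) m ι z W) 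
    (κ : ℝ) (hκ : 0 < κ) (hsep : ∀ i j, i ≠ j → 8 * κ < ‖z i - z j‖^2) :
    ∃ K K2 : ι → ℝ, (∀ i, 0 ≤ K i) ∧ (∀ i, 0 ≤ K2 i) ∧ ∀ δ : ℝ, 0 < δ → δ ≤ 1 → ((k:ℝ)+1)*(δ*(2+δ)) ≤ 8 → (δ*(2+δ)/(κ/4)^2)^(k+4) ≤ 1 →
      ∃ J B : ℝ, 0 ≤ J ∧ (∀ ε, 0 < ε → J ≤ ∑ i, W i ^ (((k:ℝ) + 1) / ((k:ℝ) + 4)) * Abd k ε (K i) δ) ∧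
        |B| ≤ ∑ i, K2 i * ∫ x, (δ*(2+δ))^(k+1) * (‖x-(1+δ)•z i‖^(2*(k+2)))⁻¹ ∂(sphMeasure (k+5)) ∧
        (SA (k+5) * (1 - (δ*(2+δ)/(κ/4)^2)^(k+4))) ^ (((k:ℝ) + 1) / ((k:ℝ) + 4)) ≤ a * J + b * B := by
  classical
  obtain ⟨hz, hW, hW1, hWp⟩ := hg
  have hne : Nonempty ι := by
    by_contra hcon
    rw [not_nonempty_iff] at hcon
    simp at hW1
  obtain ⟨χ, hχ, hχ0, hχ1, hχ2, hχ3⟩ := exists_chi κ hκ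
  have hb := fun i => bubble k (z i) (hz i) κ hκ χ hχ hχ0 hχ1 hχ2 hχ3
  choose K K2 hK hK2 hbub using hb
  set θ := ((k:ℝ) + 1) / ((k:ℝ) + 4) with hθ
  set q := 2 * ((k:ℝ) + 4) / ((k:ℝ) + 1) with hq
  have hq0 : 0 < q := by positivity
  have hqθ : 1/q*2 = θ := by rw [hq, hθ]; field_simp
  have hθ0 : 0 < θ := by positivity
  set w : ι → ℝ := fun i => W i ^ (1/q) with hw
  have hw0 : ∀ i, 0 ≤ w i := fun i => Real.rpow_nonneg (hW i) _
  have hwq : ∀ i, w i ^ q = W i := fun i => by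
    rw [hw, ← Real.rpow_mul (hW i), one_div, inv_mul_cancel₀ hq0.ne', Real.rpow_one]
  have hwθ : ∀ i, w i ^ 2 = W i ^ θ := fun i => by
    rw [hw, ← Real.rpow_natCast, ← Real.rpow_mul (hW i), ← hqθ]; norm_num
  refine ⟨K, fun i => (1+c) * (w i^2 * K2 i), hK, fun i => by have := hK2 i; positivity, ?_⟩
  intro δ hδ hδ1 hδk hδκ
  have hbub' := fun i => hbub i δ hδ hδ1 hδk
  choose u hus ha hr hl hlap hgr using hbub'
  set f : E (k+5) → ℝ := fun y => ∑ i, w i * u i y with hf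
  have hfs : ContDiff ℝ (⊤ : ℕ∞) f := ContDiff.sum fun i _ => contDiff_const.mul (hus i)
  have hloc := fun (x : E (k+5)) (hx : ‖x‖ ≤ 1) => loc_single (k+5) z hz κ hsep u hl w x hx
  -- the local form
  have hHL : ∀ i x, HasLap (k+5) (fun y => w i * u i y) x (w i • gradient (u i) x) (w i * lap (k+5) (u i) x) := fun i x =>
    ((HasLap.const (k+5) (w i) x).mul (HasLap.of_smooth (smooth2 (hus i) x))).cast (by simp) (by simp)
  have hkc : ∀ i, Continuous (fun x : E (k+5) => kf k χ δ (inner ℝ (z i) x)) := fun i => (kf_cont k χ hχ.continuous δ hδ).comp (by fun_prop)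
  have hfq : ∀ x : E (k+5), ‖x‖ = 1 → |f x|^q = ∑ i, W i * kf k χ δ (inner ℝ (z i) x) := by
    intro x hx
    obtain ⟨i0, h1, h2⟩ := hloc x hx.le
    have hterm : ∀ i, W i * kf k χ δ (inner ℝ (z i) x) = |w i * u i x|^q := by
      intro i
      rw [abs_mul, abs_of_nonneg (hw0 i), Real.mul_rpow (hw0 i) (abs_nonneg _), hwq, ha i x hx, kf_u k χ hχ0 (z i) x (hz i) hx δ hδ]
    rw [Finset.sum_eq_single i0, hterm, show f x = w i0 * u i0 x from h2.eq_of_nhds]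
    · intro i _ hi
      rw [hterm, (h1 i hi).eq_of_nhds, mul_zero, abs_zero, Real.zero_rpow hq0.ne']
    · simp
  have hIntg : ∫ x, |f x|^q ∂(sphMeasure (k+5)) = ∑ i, W i * ∫ x, kf k χ δ (inner ℝ (z i) x) ∂(sphMeasure (k+5)) := by
    rw [integral_congr_ae (g := fun x => ∑ i, W i * kf k χ δ (inner ℝ (z i) x)) (by filter_upwards [sph_ae (k+5)] with x hx using hfq x hx)]
    rw [integral_finsetSum _ fun i _ => (sph_cont_int _ _ (hkc i)).const_mul _]
    simp_rw [integral_const_mul]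
  have hcon : ∀ p ∈ P0 (k+5) m, ∫ x, MvPolynomial.eval (fun i => x i) p * |f x|^q ∂(sphMeasure (k+5)) = 0 := by
    intro p hp
    obtain ⟨P, hP, hP2⟩ := T_lemma (k+5) (by omega) (kf k χ δ) (kf_cont k χ hχ.continuous δ hδ) m p hp
    rw [integral_congr_ae (g := fun x => ∑ i, W i * (MvPolynomial.eval (fun i => x i) p * kf k χ δ (inner ℝ (z i) x)))
      (by
        filter_upwards [sph_ae (k+5)] with x hx
        rw [hfq x hx, Finset.mul_sum]
        exact Finset.sum_congr rfl fun i _ => by ring)]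
    have hpi : ∀ i, Integrable (fun x => W i * (MvPolynomial.eval (fun i => x i) p * kf k χ δ (inner ℝ (z i) x))) (sphMeasure (k+5)) :=
      fun i => (sph_cont_int _ _ ((eval_cont _ p).mul (hkc i))).const_mul _
    rw [integral_finsetSum _ fun i _ => hpi i]
    simp_rw [integral_const_mul, ← hP2 _ (hz _)]
    exact hWp P hP
  have hrad : ∀ x : E (k+5), ‖x‖ = 1 → fderiv ℝ f x x = -(((k:ℝ) + 1) / 2) * f x := by
    intro x hx
    obtain ⟨i0, h1, h2⟩ := hloc x hx.le
    rw [h2.fderiv_eq, show f x = w i0 * u i0 x from h2.eq_of_nhds, fderiv_const_mul ((hus i0).differentiable (by simp) x)]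
    have := hr i0 x hx
    rw [ContinuousLinearMap.smul_apply, smul_eq_mul, this]; ring
  have hmain := h f hfs hcon hrad
  refine ⟨_, _, integral_nonneg fun x => sq_nonneg _, ?_, ?_, le_trans ?_ hmain⟩
  · intro ε hε
    have hi : ∀ i, IntegrableOn (fun x => (lap (k+5) (u i) x)^2) (ball (0 : E (k+5)) 1) := fun i =>
      (((lap_cont _ _ (hus i)).pow 2).continuousOn.integrableOn_compact (isCompact_closedBall (0 : E (k+5)) 1)).mono_set ball_subset_closedBall
    have e1 : ∫ x in ball (0 : E (k+5)) 1, (lap (k+5) f x)^2 = ∫ x in ball (0 : E (k+5)) 1, ∑ i, W i ^ θ * (lap (k+5) (u i) x)^2 := by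
      refine setIntegral_congr_fun measurableSet_ball fun x hx => ?_
      obtain ⟨i0, h1, h2⟩ := hloc x (by simpa using (mem_ball_zero_iff.1 hx).le)
      rw [((hHL i0 x).congr h2).lapl, mul_pow, hwθ, Finset.sum_eq_single i0]
      · intro i _ hi
        rw [((HasLap.const (k+5) 0 x).congr (h1 i hi)).lapl]; ring
      · simp
    rw [e1, integral_finsetSum _ fun i _ => (hi i).const_mul _]
    refine Finset.sum_le_sum fun i _ => ?_
    rw [integral_const_mul]
    exact mul_le_mul_of_nonneg_left (lap_int k (z i) (hz i) δ hδ (u i) (hus i) (K i) (hK i) (hlap i) ε hε) (Real.rpow_nonneg (hW i) _)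
  · have hBi : ∀ i, Integrable (fun x => (δ*(2+δ))^(k+1) * (‖x-(1+δ)•z i‖^(2*(k+2)))⁻¹) (sphMeasure (k+5)) := by
      intro i
      refine Integrable.of_bound (C := (δ*(2+δ))^(k+1) * (δ^(2*(k+2)))⁻¹) (Measurable.aestronglyMeasurable (by fun_prop)) ?_
      filter_upwards [sph_ae (k+5)] with x hx
      have h1 := distP1 _ (z i) x (hz i) hx.le δ hδ
      rw [Real.norm_of_nonneg (by positivity)]
      gcongr
    simp_rw [← integral_const_mul]
    rw [← integral_finsetSum _ fun i _ => (hBi i).const_mul _, ← Real.norm_eq_abs]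
    refine norm_integral_le_of_norm_le (integrable_finsetSum _ fun i _ => (hBi i).const_mul _) ?_
    filter_upwards [sph_ae (k+5)] with x hx
    obtain ⟨i0, h1, h2⟩ := hloc x hx.le
    refine le_trans ?_ (Finset.single_le_sum (f := fun i => (1+c) * (w i^2 * K2 i) * ((δ*(2+δ))^(k+1) * (‖x-(1+δ)•z i‖^(2*(k+2)))⁻¹))
      (fun i _ => by have := hK2 i; positivity) (Finset.mem_univ i0))
    have g1 : gradient f x = w i0 • gradient (u i0) x := ((hHL i0 x).congr h2).gradient_eq
    have g2 : f x = w i0 * u i0 x := h2.eq_of_nhds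
    have g3 : fderiv ℝ f x x = inner ℝ (gradient f x) x := by
      rw [(HasLap.of_smooth (smooth2 hfs x)).grad]; rfl
    have g4 : (fderiv ℝ f x x)^2 ≤ ‖gradient f x‖^2 := by
      rw [g3, ← sq_abs]
      gcongr
      have := abs_real_inner_le_norm (gradient f x) x
      rwa [hx, mul_one] at this
    have g5 : 0 ≤ (fderiv ℝ f x x)^2 := sq_nonneg _
    rw [Real.norm_eq_abs, tgradNormSq, abs_of_nonneg (by nlinarith [mul_nonneg hc (sq_nonneg (f x))])]
    have g6 := hgr i0 x hx
    have g7 : ‖gradient f x‖^2 + c * f x^2 ≤ (1+c) * (w i0^2 * (‖gradient (u i0) x‖^2 + u i0 x^2)) := by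
      rw [g1, g2, norm_smul, mul_pow, mul_pow, Real.norm_of_nonneg (hw0 i0)]
      have : 0 ≤ c * (w i0^2 * ‖gradient (u i0) x‖^2) + w i0^2*u i0 x^2 := by positivity
      nlinarith
    have g8 : (1+c) * (w i0^2 * (‖gradient (u i0) x‖^2 + u i0 x^2)) ≤ (1+c) * (w i0^2 * (K2 i0 * ((δ*(2+δ))^(k+1) * (‖x-(1+δ)•z i0‖^(2*(k+2)))⁻¹))) := by
      gcongr
    nlinarith
  · have hSA := SA_pos (k+5) (by omega)
    refine Real.rpow_le_rpow (mul_nonneg hSA.le (by linarith)) ?_ hθ0.le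
    rw [hIntg]
    calc SA (k+5) * (1 - (δ*(2+δ)/(κ/4)^2)^(k+4)) = ∑ i, W i * (SA (k+5) * (1 - (δ*(2+δ)/(κ/4)^2)^(k+4))) := by
          rw [← Finset.sum_mul, hW1, one_mul]
      _ ≤ _ := Finset.sum_le_sum fun i _ => mul_le_mul_of_nonneg_left
          (kf_low k (z i) (hz i) κ hκ χ hχ.continuous hχ0 hχ3 δ hδ) (hW i)

theorem finite_case (k m : ℕ) (a b c : ℝ) (hc : 0 ≤ c)
    (h : ∀ f : E (k+5) → ℝ, ContDiff ℝ (⊤ : ℕ∞) f →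
      (∀ p ∈ P0 (k+5) m,
        ∫ x, MvPolynomial.eval (fun i => x i) p * |f x| ^ (2 * ((k:ℝ) + 4) / ((k:ℝ) + 1)) ∂(sphMeasure (k+5)) = 0) →
      (∀ x : E (k+5), ‖x‖ = 1 → fderiv ℝ f x x = -(((k:ℝ) + 1) / 2) * f x) →
      (∫ x, |f x| ^ (2 * ((k:ℝ) + 4) / ((k:ℝ) + 1)) ∂(sphMeasure (k+5))) ^ (((k:ℝ) + 1) / ((k:ℝ) + 4)) ≤
        a * (∫ x in Metric.ball (0 : E (k+5)) 1, (lap (k+5) f x) ^ 2) +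
          b * ∫ x, (tgradNormSq (k+5) f x + c * (f x) ^ 2) ∂(sphMeasure (k+5)))
    (S : Finset (E (k+5))) (W : E (k+5) → ℝ) (hg : FinGood (k+5) m S (fun x => x.1) (fun x => W x.1)) :
    0 < a ∧ SA (k+5) ^ (((k:ℝ) + 1) / ((k:ℝ) + 4)) ≤ a * (∑ x : S, W x.1 ^ (((k:ℝ) + 1) / ((k:ℝ) + 4))) * (((k:ℝ)+1)*(k+3)*(k+5)/4 * SA (k+5)) := by
  set θ := ((k:ℝ) + 1) / ((k:ℝ) + 4) with hθ
  have hθ0 : 0 < θ := by positivity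
  have hSA := SA_pos (k+5) (by omega)
  have hz := hg.1
  obtain ⟨κ, hκ, hsep⟩ : ∃ κ : ℝ, 0 < κ ∧ ∀ i j : S, i ≠ j → 8 * κ < ‖i.1 - j.1‖^2 := by
    have : ∀ᶠ κ in nhdsWithin (0:ℝ) (Set.Ioi 0), ∀ i j : S, i ≠ j → 8 * κ < ‖i.1 - j.1‖^2 := by
      refine nhdsWithin_le_nhds ?_
      refine eventually_all.2 fun i => eventually_all.2 fun j => ?_
      by_cases hij : i = j
      · exact Eventually.of_forall fun _ h => absurd hij h
      · have h0 : 0 < ‖i.1 - j.1‖^2 := by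
          have : 0 < ‖i.1 - j.1‖ := norm_pos_iff.2 (sub_ne_zero.2 fun h => hij (Subtype.ext h))
          positivity
        filter_upwards [gt_mem_nhds (show (0:ℝ) < ‖i.1 - j.1‖^2 / 8 by positivity)] with κ hκ _
        linarith
    obtain ⟨κ, h1, h2⟩ := (this.and self_mem_nhdsWithin).exists
    exact ⟨κ, h2, h1⟩
  obtain ⟨K, K2, hK, hK2, hmain⟩ := core k m a b c hc h (fun x : S => x.1) (fun x : S => W x.1) hg κ hκ hsep
  rw [← hθ] at hmain
  -- small parameters
  have hsm : ∀ᶠ δ in nhdsWithin (0:ℝ) (Set.Ioi 0), 0 < δ ∧ δ ≤ 1 ∧ ((k:ℝ)+1)*(δ*(2+δ)) ≤ 8 ∧ (δ*(2+δ)/(κ/4)^2)^(k+4) ≤ 1 := by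
    have h1 : ∀ᶠ δ in nhdsWithin (0:ℝ) (Set.Ioi 0), ((k:ℝ)+1)*(δ*(2+δ)) < 8 := by
      refine nhdsWithin_le_nhds ?_
      have : Continuous fun δ : ℝ => ((k:ℝ)+1)*(δ*(2+δ)) := by fun_prop
      exact this.continuousAt.eventually (gt_mem_nhds (by norm_num))
    have h2 : ∀ᶠ δ in nhdsWithin (0:ℝ) (Set.Ioi 0), (δ*(2+δ)/(κ/4)^2)^(k+4) < 1 := by
      refine nhdsWithin_le_nhds ?_
      have : Continuous fun δ : ℝ => (δ*(2+δ)/(κ/4)^2)^(k+4) := by fun_prop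
      exact this.continuousAt.eventually (gt_mem_nhds (by norm_num))
    filter_upwards [h1, h2, Ioc_mem_nhdsGT (one_pos (α := ℝ))] with δ h1 h2 h3
    exact ⟨h3.1, h3.2, h1.le, h2.le⟩
  have hlow : Tendsto (fun δ : ℝ => (SA (k+5) * (1 - (δ*(2+δ)/(κ/4)^2)^(k+4))) ^ θ) (nhdsWithin 0 (Set.Ioi 0)) (nhds (SA (k+5) ^ θ)) := by
    have : Continuous fun δ : ℝ => (SA (k+5) * (1 - (δ*(2+δ)/(κ/4)^2)^(k+4))) ^ θ :=
      Continuous.rpow_const (by fun_prop) fun _ => Or.inr hθ0.le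
    have h2 := (this.tendsto 0).mono_left (nhdsWithin_le_nhds (s := Set.Ioi 0))
    simpa using h2
  have hB : Tendsto (fun δ : ℝ => |b| * ∑ i : S, K2 i * ∫ x, (δ*(2+δ))^(k+1) * (‖x-(1+δ)•i.1‖^(2*(k+2)))⁻¹ ∂(sphMeasure (k+5)))
      (nhdsWithin 0 (Set.Ioi 0)) (nhds 0) := by
    have := (tendsto_finsetSum Finset.univ fun (i : S) _ => (B_tendsto k i.1 (hz i)).const_mul (K2 i)).const_mul |b|
    simpa using this
  have hSAθ : 0 < SA (k+5) ^ θ := Real.rpow_pos_of_pos hSA _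
  have hbB : ∀ B x : ℝ, |B| ≤ x → b * B ≤ |b| * x := fun B x hx => by
    refine (le_abs_self _).trans ?_
    rw [abs_mul]; gcongr
  have ha : 0 < a := by
    by_contra hcon
    push Not at hcon
    have : SA (k+5) ^ θ ≤ 0 := by
      refine le_of_tendsto_of_tendsto hlow hB ?_
      filter_upwards [hsm] with δ hδ
      obtain ⟨J, B, hJ, -, hB1, hle⟩ := hmain δ hδ.1 hδ.2.1 hδ.2.2.1 hδ.2.2.2
      have := hbB _ _ hB1
      nlinarith
    linarith
  refine ⟨ha, ?_⟩
  have hε : ∀ ε : ℝ, 0 < ε → SA (k+5) ^ θ ≤ a * ∑ x : S, W x.1 ^ θ * ((1+ε) * (((k:ℝ)+1)*(k+3)*(k+5)/4 * SA (k+5))) := by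
    intro ε hε
    have hA := ((tendsto_finsetSum Finset.univ fun (i : S) _ => (Abd_tendsto k ε (K i)).const_mul (W i.1 ^ θ)).const_mul a).add hB
    rw [add_zero] at hA
    refine le_of_tendsto_of_tendsto hlow hA ?_
    filter_upwards [hsm] with δ hδ
    obtain ⟨J, B, -, hJ, hB1, hle⟩ := hmain δ hδ.1 hδ.2.1 hδ.2.2.1 hδ.2.2.2
    have h1 := hbB _ _ hB1
    have h2 := mul_le_mul_of_nonneg_left (hJ ε hε) ha.le
    linarith
  have hlim : Tendsto (fun ε : ℝ => a * ∑ x : S, W x.1 ^ θ * ((1+ε) * (((k:ℝ)+1)*(k+3)*(k+5)/4 * SA (k+5)))) (nhdsWithin 0 (Set.Ioi 0))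
      (nhds (a * (∑ x : S, W x.1 ^ θ) * (((k:ℝ)+1)*(k+3)*(k+5)/4 * SA (k+5)))) := by
    have : Continuous fun ε : ℝ => a * ∑ x : S, W x.1 ^ θ * ((1+ε) * (((k:ℝ)+1)*(k+3)*(k+5)/4 * SA (k+5))) := by fun_prop
    have h2 := (this.tendsto 0).mono_left (nhdsWithin_le_nhds (s := Set.Ioi 0))
    convert h2 using 2
    rw [add_zero, one_mul, ← Finset.sum_mul, mul_assoc]
  refine ge_of_tendsto hlim ?_
  filter_upwards [self_mem_nhdsWithin] with ε h0 using hε ε h0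

theorem stmt5 (n : ℕ) (hn : 5 ≤ n) (m : ℕ) (a b : ℝ)
    (h : ∀ f u : E n → ℝ, ContDiff ℝ (⊤ : ℕ∞) f → ContDiff ℝ (⊤ : ℕ∞) u →
      (∀ p ∈ P0 n m,
        ∫ x, MvPolynomial.eval (fun i => x i) p * |f x| ^ (2 * ((n:ℝ) - 1) / ((n:ℝ) - 4))
          ∂(sphMeasure n) = 0) →
      (∀ x ∈ Metric.sphere (0 : E n) 1, u x = f x) →
      (∀ x ∈ Metric.sphere (0 : E n) 1, fderiv ℝ u x x = -(((n:ℝ) - 4) / 2) * f x) →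
      (∫ x, |f x| ^ (2 * ((n:ℝ) - 1) / ((n:ℝ) - 4)) ∂(sphMeasure n)) ^ (((n:ℝ) - 4) / ((n:ℝ) - 1)) ≤
        a * (∫ x in Metric.ball (0 : E n) 1, (lap n u x) ^ 2) +
          b * ∫ x, (tgradNormSq n f x + ((n:ℝ) * ((n:ℝ) - 4) / 2) * (f x) ^ 2) ∂(sphMeasure n)) :
    4 / ((n:ℝ) * ((n:ℝ) - 2) * ((n:ℝ) - 4) * SA n ^ ((3:ℝ) / ((n:ℝ) - 1))) /
        Theta n m (((n:ℝ) - 4) / ((n:ℝ) - 1)) ≤ a := by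
  obtain ⟨k, rfl⟩ : ∃ k, n = k + 5 := ⟨n - 5, by omega⟩
  have c1 : ((k+5:ℕ):ℝ) - 1 = (k:ℝ) + 4 := by push_cast; ring
  have c4 : ((k+5:ℕ):ℝ) - 4 = (k:ℝ) + 1 := by push_cast; ring
  have c2 : ((k+5:ℕ):ℝ) - 2 = (k:ℝ) + 3 := by push_cast; ring
  rw [c1, c4, c2]
  rw [c1, c4] at h
  have hSA := SA_pos (k+5) (by omega)
  have hSAp : 0 < SA (k+5) ^ ((3:ℝ) / ((k:ℝ)+4)) := Real.rpow_pos_of_pos hSA _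
  refine final_red (k+5) m (by omega) _ (by positivity) ?_ _ a ?_ (by positivity)
  · rw [div_le_one (by positivity)]; linarith
  · intro S W hg
    obtain ⟨ha, hle⟩ := finite_case k m a b (((k+5:ℕ):ℝ) * ((k:ℝ)+1) / 2) (by positivity)
      (fun f hf hp hr => h f f hf hf hp (fun x _ => rfl) (fun x hx => hr x (by simpa using hx))) S W hg
    refine ⟨ha, ?_⟩
    have e : SA (k+5) = SA (k+5) ^ (((k:ℝ)+1)/((k:ℝ)+4)) * SA (k+5) ^ ((3:ℝ) / ((k:ℝ)+4)) := by
      rw [← Real.rpow_add hSA, ← add_div, show (k:ℝ)+1+3 = k+4 by ring, div_self (by positivity), Real.rpow_one]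
    have hSq : 0 < SA (k+5) ^ (((k:ℝ)+1)/((k:ℝ)+4)) := Real.rpow_pos_of_pos hSA _
    rw [div_le_iff₀ (by positivity)]
    set X := SA (k+5) ^ (((k:ℝ)+1)/((k:ℝ)+4))
    set Y := SA (k+5) ^ ((3:ℝ) / ((k:ℝ)+4))
    rw [e] at hle
    refine le_of_mul_le_mul_left ?_ hSq
    push_cast
    linarith
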